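/- There exists a constant C depending only on α and d (in particular independent of ν and a) such that for every a > 0, all t₁, t₂ ∈ (aν, T) and all x₁, x₂ ∈ ℝ^d: |u(t₁,x₁) − u(t₂,x₂)| ≤ C (M₀^α M₁ + M₀ + M₁ + a^{−α/2} [u(0,·)]_{C^α}) (|t₁ − t₂|^α + |x₁ − x₂|^α). -/

import Mathlib

open MeasureTheory Set

noncomputable def heatKernel (d : ℕ) (s : ℝ) (y : EuclideanSpace ℝ (Fin d)) : ℝ :=
  (4 * Real.pi * s) ^ (-(d : ℝ) / 2) * Real.exp (-(‖y‖ ^ 2) / (4 * s))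

open Filter Topology

/-! ### Gaussian weights -/

/-- Polynomial multiples of the heat kernel at time one. -/
inductive GaussWeight (d : ℕ) : (EuclideanSpace ℝ (Fin d) → ℝ) → Prop
  | base : GaussWeight d (heatKernel d 1)
  | coord (j : Fin d) {w : EuclideanSpace ℝ (Fin d) → ℝ} :
      GaussWeight d w → GaussWeight d (fun z => z j * w z)
  | smul (c : ℝ) {w : EuclideanSpace ℝ (Fin d) → ℝ} :
      GaussWeight d w → GaussWeight d (fun z => c * w z)
  | add {w₁ w₂ : EuclideanSpace ℝ (Fin d) → ℝ} :
      GaussWeight d w₁ → GaussWeight d w₂ → GaussWeight d (fun z => w₁ z + w₂ z)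

theorem heatKernel_nonneg (d : ℕ) (z : EuclideanSpace ℝ (Fin d)) : 0 ≤ heatKernel d 1 z := by
  unfold heatKernel; positivity

theorem continuous_heatKernel (d : ℕ) : Continuous (heatKernel d 1) := by
  unfold heatKernel; fun_prop

theorem integral_heatKernel (d : ℕ) : ∫ z, heatKernel d 1 z = 1 := by
  have h := GaussianFourier.integral_rexp_neg_mul_sq_norm (V := EuclideanSpace ℝ (Fin d))
    (b := 1 / 4) (by norm_num)
  have h2 : ∀ z : EuclideanSpace ℝ (Fin d), heatKernel d 1 z
      = (4 * Real.pi) ^ (-(d : ℝ) / 2) * Real.exp (-(1 / 4) * ‖z‖ ^ 2) := by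
    intro z; unfold heatKernel; rw [mul_one, mul_one]; congr 2; ring
  simp_rw [h2]
  rw [integral_const_mul, h, finrank_euclideanSpace, Fintype.card_fin,
    show Real.pi / (1 / 4) = 4 * Real.pi by ring, ← Real.rpow_add (by positivity)]
  rw [show -(d : ℝ) / 2 + (d : ℝ) / 2 = 0 by ring, Real.rpow_zero]

theorem integrable_exp_neg_mul_sq_norm (d : ℕ) {b : ℝ} (hb : 0 < b) :
    Integrable (fun z : EuclideanSpace ℝ (Fin d) => Real.exp (-b * ‖z‖ ^ 2)) := by
  by_contra h
  have h1 := GaussianFourier.integral_rexp_neg_mul_sq_norm (V := EuclideanSpace ℝ (Fin d)) hb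
  rw [integral_undef h] at h1
  have : 0 < (Real.pi / b) ^ ((Module.finrank ℝ (EuclideanSpace ℝ (Fin d)) : ℝ) / 2) := by
    positivity
  linarith

theorem integrable_norm_pow_mul_heatKernel (d n : ℕ) :
    Integrable (fun z : EuclideanSpace ℝ (Fin d) => ‖z‖ ^ n * heatKernel d 1 z) := by
  have hi := (integrable_exp_neg_mul_sq_norm d (b := 1 / 8) (by norm_num)).const_mul
    ((4 * Real.pi * 1) ^ (-(d : ℝ) / 2) * (n.factorial * Real.exp 2))
  refine hi.mono' (by have := continuous_heatKernel d; fun_prop) (.of_forall fun z => ?_)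
  rw [Real.norm_of_nonneg (mul_nonneg (by positivity) (heatKernel_nonneg d z))]
  unfold heatKernel
  have h1 : ‖z‖ ^ n ≤ n.factorial * Real.exp ‖z‖ := by
    have := Real.pow_div_factorial_le_exp ‖z‖ (norm_nonneg z) n
    rwa [div_le_iff₀ (by positivity), mul_comm] at this
  have h2 : Real.exp ‖z‖ * Real.exp (-(‖z‖ ^ 2) / (4 * 1))
      ≤ Real.exp 2 * Real.exp (-(1 / 8) * ‖z‖ ^ 2) := by
    rw [← Real.exp_add, ← Real.exp_add]
    apply Real.exp_le_exp.2
    nlinarith [sq_nonneg (‖z‖ - 4)]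
  have hK : (0 : ℝ) ≤ (4 * Real.pi * 1) ^ (-(d : ℝ) / 2) := by positivity
  calc ‖z‖ ^ n * ((4 * Real.pi * 1) ^ (-(d : ℝ) / 2) * Real.exp (-(‖z‖ ^ 2) / (4 * 1)))
      ≤ (n.factorial * Real.exp ‖z‖)
          * ((4 * Real.pi * 1) ^ (-(d : ℝ) / 2) * Real.exp (-(‖z‖ ^ 2) / (4 * 1))) := by
        gcongr
    _ = (4 * Real.pi * 1) ^ (-(d : ℝ) / 2) * n.factorial
          * (Real.exp ‖z‖ * Real.exp (-(‖z‖ ^ 2) / (4 * 1))) := by ring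
    _ ≤ (4 * Real.pi * 1) ^ (-(d : ℝ) / 2) * n.factorial
          * (Real.exp 2 * Real.exp (-(1 / 8) * ‖z‖ ^ 2)) := by gcongr
    _ = _ := by ring

namespace GaussWeight

variable {d : ℕ} {w : EuclideanSpace ℝ (Fin d) → ℝ}

theorem continuous (hw : GaussWeight d w) : Continuous w := by
  induction hw with
  | base => exact continuous_heatKernel d
  | coord j _ ih => fun_prop
  | smul c _ ih => fun_prop
  | add _ _ ih₁ ih₂ => fun_prop

theorem integrable_norm_pow_mul (hw : GaussWeight d w) (n : ℕ) :
    Integrable (fun z => ‖z‖ ^ n * w z) := by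
  induction hw generalizing n with
  | base => exact integrable_norm_pow_mul_heatKernel d n
  | @coord j w hw ih =>
    refine (ih (n + 1)).mono (by have := hw.continuous; fun_prop) (.of_forall fun z => ?_)
    have h := PiLp.norm_apply_le z j
    simp only [norm_mul, norm_pow, norm_norm]
    calc ‖z‖ ^ n * (‖z j‖ * ‖w z‖) ≤ ‖z‖ ^ n * (‖z‖ * ‖w z‖) := by gcongr
      _ = _ := by ring
  | @smul c w _ ih =>
    refine ((ih n).const_mul c).congr (.of_forall fun z => ?_)
    simp only; ring
  | @add w₁ w₂ _ _ ih₁ ih₂ =>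
    refine ((ih₁ n).add (ih₂ n)).congr (.of_forall fun z => ?_)
    simp only [Pi.add_apply]; ring

theorem integrable (hw : GaussWeight d w) : Integrable w := by
  simpa using hw.integrable_norm_pow_mul 0

theorem integrable_one_add_norm_mul (hw : GaussWeight d w) :
    Integrable (fun z => (1 + ‖z‖) * |w z|) := by
  have h := hw.integrable.norm.add (hw.integrable_norm_pow_mul 1).norm
  refine h.congr (.of_forall fun z => ?_)
  simp only [Pi.add_apply, norm_mul, Real.norm_eq_abs, pow_one, abs_norm]; ring

/-- The total mass of a weight against `1 + ‖z‖`. -/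
theorem integral_one_add_norm_mul_nonneg (w : EuclideanSpace ℝ (Fin d) → ℝ) :
    0 ≤ ∫ z, (1 + ‖z‖) * |w z| :=
  integral_nonneg fun z => by positivity

theorem hasLineDerivAt_heatKernel (j : Fin d) (z : EuclideanSpace ℝ (Fin d)) :
    HasLineDerivAt ℝ (heatKernel d 1) (-(1 / 2) * (z j * heatKernel d 1 z)) z
      (EuclideanSpace.single j 1) := by
  unfold HasLineDerivAt heatKernel
  have h : ∀ t : ℝ, ‖z + t • EuclideanSpace.single j (1 : ℝ)‖ ^ 2
      = ‖z‖ ^ 2 + 2 * t * z j + t ^ 2 := by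
    intro t
    rw [norm_add_sq_real, inner_smul_right, EuclideanSpace.inner_single_right, norm_smul]
    simp
    ring
  simp_rw [h]
  have h1 : HasDerivAt (fun t : ℝ => -(‖z‖ ^ 2 + 2 * t * z j + t ^ 2) / (4 * 1))
      (-(1 / 2) * z j) 0 := by
    have h2 := ((((hasDerivAt_id (0 : ℝ)).const_mul 2).mul_const (z j)).const_add (‖z‖ ^ 2)).add
      (hasDerivAt_pow 2 (0 : ℝ))
    convert! (h2.neg.div_const (4 * 1)) using 1
    simp; ring
  convert! (h1.exp.const_mul ((4 * Real.pi * 1) ^ (-(d : ℝ) / 2))) using 1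
  simp; ring

theorem exists_hasLineDerivAt (hw : GaussWeight d w) (j : Fin d) :
    ∃ w', GaussWeight d w' ∧ ∀ z, HasLineDerivAt ℝ w (w' z) z (EuclideanSpace.single j 1) := by
  induction hw with
  | base => exact ⟨_, .smul _ (.coord j .base), hasLineDerivAt_heatKernel j⟩
  | @coord k w hw ih =>
    obtain ⟨w', hw', h⟩ := ih
    refine ⟨_, .add (.smul (EuclideanSpace.single j (1 : ℝ) k) hw) (.coord k hw'), fun z => ?_⟩
    have h1 : HasDerivAt (fun t : ℝ => (z + t • EuclideanSpace.single j (1 : ℝ)) k)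
        (EuclideanSpace.single j (1 : ℝ) k) 0 := by
      have := ((hasDerivAt_id (0 : ℝ)).mul_const (EuclideanSpace.single j (1 : ℝ) k)).const_add (z k)
      simpa using this
    unfold HasLineDerivAt
    convert! HasDerivAt.mul h1 (h z) using 1
    simp
  | @smul c w _ ih =>
    obtain ⟨w', hw', h⟩ := ih
    exact ⟨_, .smul c hw', fun z => HasDerivAt.const_mul c (h z)⟩
  | @add w₁ w₂ _ _ ih₁ ih₂ =>
    obtain ⟨w₁', hw₁', h₁⟩ := ih₁
    obtain ⟨w₂', hw₂', h₂⟩ := ih₂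
    exact ⟨_, .add hw₁' hw₂', fun z => HasDerivAt.add (h₁ z) (h₂ z)⟩

theorem integrable_mul (hw : GaussWeight d w) {g : EuclideanSpace ℝ (Fin d) → ℝ}
    (hg : Continuous g) {B : ℝ} (hB : ∀ z, |g z| ≤ B) : Integrable (fun z => g z * w z) :=
  hw.integrable.bdd_mul hg.aestronglyMeasurable (.of_forall hB)

/-- Integration by parts against a Gaussian weight. -/
theorem integral_mul_lineDeriv (hw : GaussWeight d w) {w' g g' : EuclideanSpace ℝ (Fin d) → ℝ}
    (hw' : GaussWeight d w') {j : Fin d}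
    (hww' : ∀ z, HasLineDerivAt ℝ w (w' z) z (EuclideanSpace.single j 1))
    (hg : Continuous g) (hg' : Continuous g') {B B' : ℝ} (hB : ∀ z, |g z| ≤ B)
    (hB' : ∀ z, |g' z| ≤ B')
    (hgg' : ∀ z, HasLineDerivAt ℝ g (g' z) z (EuclideanSpace.single j 1)) :
    ∫ z, g z * w' z = -∫ z, g' z * w z :=
  integral_bilinear_hasLineDerivAt_right_eq_neg_left_of_integrable
    (B := ContinuousLinearMap.mul ℝ ℝ) (hw.integrable_mul hg' hB') (hw'.integrable_mul hg hB)
    (hw.integrable_mul hg hB) (fun z _ => hgg' z) (fun z _ => hww' z)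

theorem integral_lineDeriv_eq_zero (hw : GaussWeight d w) {w' : EuclideanSpace ℝ (Fin d) → ℝ}
    (hw' : GaussWeight d w') {j : Fin d}
    (hww' : ∀ z, HasLineDerivAt ℝ w (w' z) z (EuclideanSpace.single j 1)) :
    ∫ z, w' z = 0 := by
  have h := hw.integral_mul_lineDeriv hw' hww' (g := fun _ => 1) (g' := fun _ => 0)
    continuous_const continuous_const (B := 1) (B' := 0) (by simp) (by simp)
    (fun z => by simpa [HasLineDerivAt] using hasDerivAt_const (0 : ℝ) (1 : ℝ))
  simpa using h

theorem abs_integral_mul_le (hw : GaussWeight d w) {g : EuclideanSpace ℝ (Fin d) → ℝ}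
    {B : ℝ} (hB : ∀ z, |g z| ≤ B) :
    |∫ z, g z * w z| ≤ B * ∫ z, (1 + ‖z‖) * |w z| := by
  have hB0 : 0 ≤ B := (abs_nonneg _).trans (hB 0)
  rw [← integral_const_mul, ← Real.norm_eq_abs]
  refine norm_integral_le_of_norm_le (hw.integrable_one_add_norm_mul.const_mul B)
    (.of_forall fun z => ?_)
  rw [norm_mul, Real.norm_eq_abs, Real.norm_eq_abs]
  gcongr
  · exact hB z
  · nlinarith [norm_nonneg z, abs_nonneg (w z)]

/-- Averaging the increments of a Hölder function. -/
theorem abs_integral_sub_mul_le (hw : GaussWeight d w) {g : EuclideanSpace ℝ (Fin d) → ℝ}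
    {α L c : ℝ} (hα : 0 < α) (hα1 : α < 1) (hc : 0 ≤ c) (hL : 0 ≤ L)
    (x : EuclideanSpace ℝ (Fin d)) (hg : ∀ y, |g y - g x| ≤ L * ‖y - x‖ ^ α) :
    |∫ z, (g (x + c • z) - g x) * w z| ≤ L * c ^ α * ∫ z, (1 + ‖z‖) * |w z| := by
  rw [← integral_const_mul, ← Real.norm_eq_abs]
  refine norm_integral_le_of_norm_le (hw.integrable_one_add_norm_mul.const_mul _)
    (.of_forall fun z => ?_)
  have h1 := hg (x + c • z)
  rw [add_sub_cancel_left, norm_smul, Real.norm_of_nonneg hc,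
    Real.mul_rpow hc (norm_nonneg z)] at h1
  have h2 : ‖z‖ ^ α ≤ 1 + ‖z‖ := by
    calc ‖z‖ ^ α ≤ (1 + ‖z‖) ^ α := by gcongr; linarith
      _ ≤ (1 + ‖z‖) ^ (1 : ℝ) :=
        Real.rpow_le_rpow_of_exponent_le (by linarith [norm_nonneg z]) hα1.le
      _ = _ := Real.rpow_one _
  rw [norm_mul, Real.norm_eq_abs, Real.norm_eq_abs]
  calc |g (x + c • z) - g x| * |w z| ≤ (L * (c ^ α * ‖z‖ ^ α)) * |w z| := by gcongr
    _ ≤ (L * (c ^ α * (1 + ‖z‖))) * |w z| := by gcongr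
    _ = _ := by ring

end GaussWeight

/-! ### Smooth functions of time and space, periodic in space -/

/-- The slab `(0, T) × ℝ^d`. -/
abbrev slab (d : ℕ) (T : ℝ) : Set (ℝ × EuclideanSpace ℝ (Fin d)) := Ioo 0 T ×ˢ univ

theorem isOpen_slab (d : ℕ) (T : ℝ) : IsOpen (slab d T) := isOpen_Ioo.prod isOpen_univ

/-- The directional derivative of a function of time and space. -/
noncomputable def dirDeriv {d : ℕ} (v : ℝ × EuclideanSpace ℝ (Fin d))
    (f : ℝ × EuclideanSpace ℝ (Fin d) → ℝ) : ℝ × EuclideanSpace ℝ (Fin d) → ℝ :=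
  fun q => fderiv ℝ f q v

/-- The partial derivative in the time direction. -/
noncomputable def timeDeriv {d : ℕ} (f : ℝ × EuclideanSpace ℝ (Fin d) → ℝ) :
    ℝ × EuclideanSpace ℝ (Fin d) → ℝ :=
  dirDeriv (1, 0) f

/-- The partial derivative in the `j`-th space direction. -/
noncomputable def spaceDeriv {d : ℕ} (j : Fin d) (f : ℝ × EuclideanSpace ℝ (Fin d) → ℝ) :
    ℝ × EuclideanSpace ℝ (Fin d) → ℝ :=
  dirDeriv (0, EuclideanSpace.single j 1) f

/-- The Laplacian in the space variable. -/
noncomputable def spaceLaplacian {d : ℕ} (f : ℝ × EuclideanSpace ℝ (Fin d) → ℝ) :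
    ℝ × EuclideanSpace ℝ (Fin d) → ℝ :=
  fun q => ∑ j, spaceDeriv j (spaceDeriv j f) q

/-- Smooth functions on the slab that are periodic in space. -/
structure SmoothPeriodic {d : ℕ} (T : ℝ) {F : Type*} [NormedAddCommGroup F] [NormedSpace ℝ F]
    (f : ℝ × EuclideanSpace ℝ (Fin d) → F) : Prop where
  contDiffOn : ContDiffOn ℝ (⊤ : ℕ∞) f (slab d T)
  periodic : ∀ t ∈ Ioo (0 : ℝ) T, ∀ (x : EuclideanSpace ℝ (Fin d)) (n : Fin d → ℤ),
    f (t, x + (EuclideanSpace.equiv (Fin d) ℝ).symm (fun i => (n i : ℝ))) = f (t, x)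

section

variable {d : ℕ} {T : ℝ} {F : Type*} [NormedAddCommGroup F] [NormedSpace ℝ F]

theorem exists_lattice_translate_norm_le (x : EuclideanSpace ℝ (Fin d)) :
    ∃ n : Fin d → ℤ,
      ‖x + (EuclideanSpace.equiv (Fin d) ℝ).symm (fun i => (n i : ℝ))‖ ≤ √d := by
  refine ⟨fun i => -⌊x i⌋, ?_⟩
  rw [EuclideanSpace.norm_eq]
  apply Real.sqrt_le_sqrt
  calc _ ≤ ∑ i : Fin d, (1 : ℝ) := by
        refine Finset.sum_le_sum fun i _ => ?_
        have h0 := Int.floor_le (x i)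
        have h1 := (Int.lt_floor_add_one (x i)).le
        simp only [PiLp.add_apply, EuclideanSpace.equiv, Int.cast_neg, Real.norm_eq_abs, sq_abs]
        have : x i + -(⌊x i⌋ : ℝ) ≤ 1 := by linarith
        exact pow_le_one₀ (by show 0 ≤ x i + -(⌊x i⌋ : ℝ); linarith) this
    _ = d := by simp

namespace SmoothPeriodic

theorem differentiableAt {f : ℝ × EuclideanSpace ℝ (Fin d) → F} (hf : SmoothPeriodic T f)
    {q : ℝ × EuclideanSpace ℝ (Fin d)} (hq : q ∈ slab d T) : DifferentiableAt ℝ f q :=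
  (hf.contDiffOn.contDiffAt ((isOpen_slab d T).mem_nhds hq)).differentiableAt (by simp)

theorem continuous_slice {f : ℝ × EuclideanSpace ℝ (Fin d) → F} (hf : SmoothPeriodic T f)
    {t : ℝ} (ht : t ∈ Ioo 0 T) : Continuous fun x => f (t, x) := by
  refine hf.contDiffOn.continuousOn.comp_continuous (by fun_prop) fun x => ⟨ht, trivial⟩

theorem of_fderiv {f : ℝ × EuclideanSpace ℝ (Fin d) → F} (hf : SmoothPeriodic T f) :
    SmoothPeriodic T (fderiv ℝ f) where
  contDiffOn := hf.contDiffOn.fderiv_of_isOpen (isOpen_slab d T) (by simp)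
  periodic t ht x n := by
    set v : EuclideanSpace ℝ (Fin d) :=
      (EuclideanSpace.equiv (Fin d) ℝ).symm (fun i => (n i : ℝ))
    have h1 := fderiv_comp_add_right (𝕜 := ℝ) (f := f) (x := (t, x)) (0, v)
    have h2 : (fun q => f (q + (0, v))) =ᶠ[𝓝 (t, x)] f := by
      filter_upwards [(isOpen_slab d T).mem_nhds (show (t, x) ∈ slab d T from ⟨ht, trivial⟩)]
        with q hq
      have := hf.periodic q.1 hq.1 q.2 n
      rwa [show (q.1, q.2 + v) = q + (0, v) by simp [Prod.ext_iff]] at this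
    rw [h2.fderiv_eq] at h1
    rw [h1]
    simp

theorem exists_bound {f : ℝ × EuclideanSpace ℝ (Fin d) → F} (hf : SmoothPeriodic T f)
    {a b : ℝ} (ha : 0 < a) (hb : b < T) : ∃ B, ∀ t ∈ Icc a b, ∀ x, ‖f (t, x)‖ ≤ B := by
  have hK : IsCompact (Icc a b ×ˢ Metric.closedBall (0 : EuclideanSpace ℝ (Fin d)) (√d)) :=
    isCompact_Icc.prod (isCompact_closedBall _ _)
  have hsub : Icc a b ×ˢ Metric.closedBall (0 : EuclideanSpace ℝ (Fin d)) (√d) ⊆ slab d T :=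
    fun q hq => ⟨⟨ha.trans_le hq.1.1, hq.1.2.trans_lt hb⟩, trivial⟩
  obtain ⟨B, hB⟩ := hK.exists_bound_of_continuousOn (hf.contDiffOn.continuousOn.mono hsub)
  refine ⟨B, fun t ht x => ?_⟩
  obtain ⟨n, hn⟩ := exists_lattice_translate_norm_le x
  rw [← hf.periodic t ⟨ha.trans_le ht.1, ht.2.trans_lt hb⟩ x n]
  exact hB _ ⟨ht, by simpa using hn⟩

theorem exists_bound_slice {f : ℝ × EuclideanSpace ℝ (Fin d) → F} (hf : SmoothPeriodic T f)
    {t : ℝ} (ht : t ∈ Ioo 0 T) : ∃ B, ∀ x, ‖f (t, x)‖ ≤ B := by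
  obtain ⟨B, hB⟩ := hf.exists_bound ht.1 ht.2
  exact ⟨B, hB t ⟨le_rfl, le_rfl⟩⟩

variable {f g : ℝ × EuclideanSpace ℝ (Fin d) → ℝ}

theorem of_dirDeriv (hf : SmoothPeriodic T f) (v : ℝ × EuclideanSpace ℝ (Fin d)) :
    SmoothPeriodic T (dirDeriv v f) where
  contDiffOn := hf.of_fderiv.contDiffOn.clm_apply contDiffOn_const
  periodic t ht x n := by
    unfold dirDeriv
    rw [hf.of_fderiv.periodic t ht x n]

theorem of_timeDeriv (hf : SmoothPeriodic T f) : SmoothPeriodic T (timeDeriv f) := hf.of_dirDeriv _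

theorem of_spaceDeriv (hf : SmoothPeriodic T f) (j : Fin d) : SmoothPeriodic T (spaceDeriv j f) :=
  hf.of_dirDeriv _

theorem add (hf : SmoothPeriodic T f) (hg : SmoothPeriodic T g) :
    SmoothPeriodic T (fun q => f q + g q) where
  contDiffOn := hf.contDiffOn.add hg.contDiffOn
  periodic t ht x n := by rw [hf.periodic t ht x n, hg.periodic t ht x n]

theorem mul (hf : SmoothPeriodic T f) (hg : SmoothPeriodic T g) :
    SmoothPeriodic T (fun q => f q * g q) where
  contDiffOn := hf.contDiffOn.mul hg.contDiffOn
  periodic t ht x n := by rw [hf.periodic t ht x n, hg.periodic t ht x n]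

theorem const_mul (hf : SmoothPeriodic T f) (c : ℝ) : SmoothPeriodic T (fun q => c * f q) where
  contDiffOn := contDiffOn_const.mul hf.contDiffOn
  periodic t ht x n := by rw [hf.periodic t ht x n]

theorem sum {ι : Type*} {s : Finset ι} {f : ι → ℝ × EuclideanSpace ℝ (Fin d) → ℝ}
    (hf : ∀ i ∈ s, SmoothPeriodic T (f i)) : SmoothPeriodic T (fun q => ∑ i ∈ s, f i q) where
  contDiffOn := ContDiffOn.sum fun i hi => (hf i hi).contDiffOn
  periodic t ht x n := Finset.sum_congr rfl fun i hi => (hf i hi).periodic t ht x n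

theorem of_spaceLaplacian (hf : SmoothPeriodic T f) : SmoothPeriodic T (spaceLaplacian f) :=
  sum fun j _ => (hf.of_spaceDeriv j).of_spaceDeriv j

theorem dirDeriv_comm (hf : SmoothPeriodic T f) (v w : ℝ × EuclideanSpace ℝ (Fin d)) :
    EqOn (dirDeriv v (dirDeriv w f)) (dirDeriv w (dirDeriv v f))
      (slab d T) := by
  intro q hq
  have hd : DifferentiableAt ℝ (fderiv ℝ f) q := hf.of_fderiv.differentiableAt hq
  have key : ∀ a b : ℝ × EuclideanSpace ℝ (Fin d),
      dirDeriv a (dirDeriv b f) q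
        = fderiv ℝ (fderiv ℝ f) q a b := by
    intro a b
    unfold dirDeriv
    rw [fderiv_clm_apply hd (differentiableAt_const b)]
    simp
  rw [key, key]
  exact (hf.contDiffOn.contDiffAt ((isOpen_slab d T).mem_nhds hq)).isSymmSndFDerivAt
    (by
      simp only [minSmoothness_of_isRCLikeNormedField]
      exact WithTop.coe_le_coe.2 (le_top : (2 : ℕ∞) ≤ ⊤)) v w

theorem dirDeriv_add (hf : SmoothPeriodic T f) (hg : SmoothPeriodic T g)
    (v : ℝ × EuclideanSpace ℝ (Fin d)) :
    EqOn (dirDeriv v (fun q => f q + g q))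
      (fun q => dirDeriv v f q + dirDeriv v g q) (slab d T) := by
  intro q hq
  simp only [dirDeriv]
  rw [fderiv_fun_add (hf.differentiableAt hq) (hg.differentiableAt hq)]
  simp

theorem dirDeriv_mul (hf : SmoothPeriodic T f) (hg : SmoothPeriodic T g)
    (v : ℝ × EuclideanSpace ℝ (Fin d)) :
    EqOn (dirDeriv v (fun q => f q * g q))
      (fun q => f q * dirDeriv v g q + g q * dirDeriv v f q) (slab d T) := by
  intro q hq
  simp only [dirDeriv]
  rw [fderiv_fun_mul (hf.differentiableAt hq) (hg.differentiableAt hq)]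
  simp

theorem dirDeriv_const_mul (hf : SmoothPeriodic T f) (c : ℝ)
    (v : ℝ × EuclideanSpace ℝ (Fin d)) :
    EqOn (dirDeriv v (fun q => c * f q)) (fun q => c * dirDeriv v f q)
      (slab d T) := by
  intro q hq
  simp only [dirDeriv]
  rw [fderiv_const_mul (hf.differentiableAt hq)]
  simp

theorem dirDeriv_sum {ι : Type*} {s : Finset ι} {f : ι → ℝ × EuclideanSpace ℝ (Fin d) → ℝ}
    (hf : ∀ i ∈ s, SmoothPeriodic T (f i)) (v : ℝ × EuclideanSpace ℝ (Fin d)) :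
    EqOn (dirDeriv v (fun q => ∑ i ∈ s, f i q))
      (fun q => ∑ i ∈ s, dirDeriv v (f i) q) (slab d T) := by
  intro q hq
  simp only [dirDeriv]
  rw [fderiv_fun_sum fun i hi => (hf i hi).differentiableAt hq]
  simp

end SmoothPeriodic

theorem dirDeriv_congr {f g : ℝ × EuclideanSpace ℝ (Fin d) → ℝ} (h : EqOn f g (slab d T))
    (v : ℝ × EuclideanSpace ℝ (Fin d)) : EqOn (dirDeriv v f) (dirDeriv v g) (slab d T) := by
  intro q hq
  unfold dirDeriv
  rw [(h.eventuallyEq_of_mem ((isOpen_slab d T).mem_nhds hq)).fderiv_eq]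

end

/-! ### Gaussian averages in space -/

/-- The average of `f (t, ·)` around `x` at scale `c` against the weight `w`. -/
noncomputable def gaussAvg {d : ℕ} (w : EuclideanSpace ℝ (Fin d) → ℝ)
    (f : ℝ × EuclideanSpace ℝ (Fin d) → ℝ) (x : EuclideanSpace ℝ (Fin d)) (t c : ℝ) : ℝ :=
  ∫ z, f (t, x + c • z) * w z

/-- The heat semigroup at time `s` applied to `f (t, ·)`, evaluated at `x`. -/
noncomputable def heatFlow {d : ℕ} (f : ℝ × EuclideanSpace ℝ (Fin d) → ℝ)
    (x : EuclideanSpace ℝ (Fin d)) (t s : ℝ) : ℝ :=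
  gaussAvg (heatKernel d 1) f x t (√s)

section

variable {d : ℕ} {T : ℝ} {f g : ℝ × EuclideanSpace ℝ (Fin d) → ℝ}
  {w w' : EuclideanSpace ℝ (Fin d) → ℝ} {x : EuclideanSpace ℝ (Fin d)} {t c s : ℝ}

theorem gaussAvg_congr (h : EqOn f g (slab d T)) (ht : t ∈ Ioo 0 T) :
    gaussAvg w f x t c = gaussAvg w g x t c := by
  unfold gaussAvg
  congr 1; ext z
  rw [h ⟨ht, trivial⟩]

theorem SmoothPeriodic.hasLineDerivAt_slice (hf : SmoothPeriodic T f) (ht : t ∈ Ioo 0 T)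
    (x : EuclideanSpace ℝ (Fin d)) (c : ℝ) (j : Fin d) (z : EuclideanSpace ℝ (Fin d)) :
    HasLineDerivAt ℝ (fun z => f (t, x + c • z)) (c * spaceDeriv j f (t, x + c • z)) z
      (EuclideanSpace.single j 1) := by
  have h1 : HasFDerivAt (fun z : EuclideanSpace ℝ (Fin d) => (t, x + c • z))
      ((0 : EuclideanSpace ℝ (Fin d) →L[ℝ] ℝ).prod (c • ContinuousLinearMap.id ℝ _)) z :=
    (hasFDerivAt_const t z).prodMk (((hasFDerivAt_id z).const_smul c).const_add x)
  have h2 := ((hf.differentiableAt (q := (t, x + c • z)) ⟨ht, trivial⟩).hasFDerivAt.comp z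
    h1).hasLineDerivAt (EuclideanSpace.single j 1)
  convert! h2 using 1
  simp only [spaceDeriv, dirDeriv, ContinuousLinearMap.comp_apply, ContinuousLinearMap.prod_apply,
    zero_apply, smul_apply, ContinuousLinearMap.id_apply]
  rw [← smul_eq_mul, ← map_smul]
  simp

theorem SmoothPeriodic.gaussAvg_lineDeriv (hf : SmoothPeriodic T f) (ht : t ∈ Ioo 0 T)
    (hw : GaussWeight d w) (hw' : GaussWeight d w') {j : Fin d}
    (hww' : ∀ z, HasLineDerivAt ℝ w (w' z) z (EuclideanSpace.single j 1)) :
    gaussAvg w' f x t c = -(c * gaussAvg w (spaceDeriv j f) x t c) := by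
  obtain ⟨B, hB⟩ := hf.exists_bound_slice ht
  obtain ⟨B', hB'⟩ := (hf.of_spaceDeriv j).exists_bound_slice ht
  have hf0 := hf.continuous_slice ht
  have hf1 := (hf.of_spaceDeriv j).continuous_slice ht
  unfold gaussAvg
  rw [hw.integral_mul_lineDeriv hw' hww' (g := fun z => f (t, x + c • z))
    (g' := fun z => c * spaceDeriv j f (t, x + c • z))
    (hf0.comp (by fun_prop : Continuous fun z : EuclideanSpace ℝ (Fin d) => x + c • z))
    (continuous_const.mul
      (hf1.comp (by fun_prop : Continuous fun z : EuclideanSpace ℝ (Fin d) => x + c • z)))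
    (B := B) (B' := |c| * B') (fun z => hB _) (fun z => ?_)
    (hf.hasLineDerivAt_slice ht x c j), ← integral_const_mul]
  · simp_rw [mul_assoc]
  · rw [abs_mul]
    exact mul_le_mul_of_nonneg_left (hB' _) (abs_nonneg c)

theorem SmoothPeriodic.integrable_gaussAvg (hf : SmoothPeriodic T f) (ht : t ∈ Ioo 0 T)
    (hw : GaussWeight d w) (x : EuclideanSpace ℝ (Fin d)) (c : ℝ) :
    Integrable fun z => f (t, x + c • z) * w z := by
  obtain ⟨B, hB⟩ := hf.exists_bound_slice ht
  exact hw.integrable_mul ((hf.continuous_slice ht).comp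
    (by fun_prop : Continuous fun z : EuclideanSpace ℝ (Fin d) => x + c • z)) (fun z => hB _)

theorem gaussAvg_add (hf : SmoothPeriodic T f) (hg : SmoothPeriodic T g) (ht : t ∈ Ioo 0 T)
    (hw : GaussWeight d w) :
    gaussAvg w (fun q => f q + g q) x t c = gaussAvg w f x t c + gaussAvg w g x t c := by
  unfold gaussAvg
  rw [← integral_add (hf.integrable_gaussAvg ht hw x c) (hg.integrable_gaussAvg ht hw x c)]
  simp_rw [add_mul]

theorem gaussAvg_const_mul (a : ℝ) :
    gaussAvg w (fun q => a * f q) x t c = a * gaussAvg w f x t c := by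
  unfold gaussAvg
  rw [← integral_const_mul]
  simp_rw [mul_assoc]

theorem gaussAvg_sum {ι : Type*} {I : Finset ι} {f : ι → ℝ × EuclideanSpace ℝ (Fin d) → ℝ}
    (hf : ∀ i ∈ I, SmoothPeriodic T (f i)) (ht : t ∈ Ioo 0 T) (hw : GaussWeight d w) :
    gaussAvg w (fun q => ∑ i ∈ I, f i q) x t c = ∑ i ∈ I, gaussAvg w (f i) x t c := by
  unfold gaussAvg
  rw [← integral_finsetSum _ fun i hi => (hf i hi).integrable_gaussAvg ht hw x c]
  simp_rw [Finset.sum_mul]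

/-- The linear map `(h, k) ↦ (h, k • z)`. -/
noncomputable def scaleMap {d : ℕ} (z : EuclideanSpace ℝ (Fin d)) :
    ℝ × ℝ →L[ℝ] ℝ × EuclideanSpace ℝ (Fin d) :=
  (ContinuousLinearMap.fst ℝ ℝ ℝ).prod ((ContinuousLinearMap.snd ℝ ℝ ℝ).smulRight z)

theorem norm_scaleMap_le (z : EuclideanSpace ℝ (Fin d)) : ‖scaleMap z‖ ≤ 1 + ‖z‖ := by
  refine ContinuousLinearMap.opNorm_le_bound _ (by positivity) fun q => ?_
  have h1 := norm_fst_le q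
  have h2 := norm_snd_le q
  simp only [scaleMap, ContinuousLinearMap.prod_apply, ContinuousLinearMap.coe_fst',
    ContinuousLinearMap.smulRight_apply, ContinuousLinearMap.coe_snd', Prod.norm_mk, norm_smul]
  refine max_le ?_ ?_
  · nlinarith [norm_nonneg z, norm_nonneg q]
  · nlinarith [norm_nonneg z, norm_nonneg q, mul_le_mul_of_nonneg_right h2 (norm_nonneg z)]

theorem continuous_scaleMap : Continuous (scaleMap (d := d)) := by
  have : Continuous fun z : EuclideanSpace ℝ (Fin d) =>
      (ContinuousLinearMap.snd ℝ ℝ ℝ).smulRight z :=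
    (ContinuousLinearMap.smulRightL ℝ (ℝ × ℝ) _ (ContinuousLinearMap.snd ℝ ℝ ℝ)).continuous
  unfold scaleMap
  exact (ContinuousLinearMap.prodₗᵢ ℝ).continuous.comp (continuous_const.prodMk this)

theorem SmoothPeriodic.hasFDerivAt_gaussAvg (hf : SmoothPeriodic T f) (ht : t ∈ Ioo 0 T)
    (x : EuclideanSpace ℝ (Fin d)) (c : ℝ) :
    HasFDerivAt (fun q : ℝ × ℝ => gaussAvg (heatKernel d 1) f x q.1 q.2)
      (gaussAvg (heatKernel d 1) (timeDeriv f) x t c • ContinuousLinearMap.fst ℝ ℝ ℝ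
        + (2 * c * gaussAvg (heatKernel d 1) (spaceLaplacian f) x t c) •
          ContinuousLinearMap.snd ℝ ℝ ℝ) (t, c) := by
  have hγ := GaussWeight.base (d := d)
  obtain ⟨a, ha0, hat⟩ := exists_between ht.1
  obtain ⟨b, hbt, hbT⟩ := exists_between ht.2
  obtain ⟨B, hB⟩ := hf.of_fderiv.exists_bound ha0 hbT
  have hslab : ∀ r ∈ Ioo a b, r ∈ Ioo 0 T := fun r hr => ⟨ha0.trans hr.1, hr.2.trans hbT⟩
  set F' : ℝ × ℝ → EuclideanSpace ℝ (Fin d) → (ℝ × ℝ →L[ℝ] ℝ) := fun q z =>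
    heatKernel d 1 z • (fderiv ℝ f (q.1, x + q.2 • z)).comp (scaleMap z) with hF'
  have hcont : ∀ r ∈ Ioo 0 T, ∀ k : ℝ,
      Continuous fun z : EuclideanSpace ℝ (Fin d) => fderiv ℝ f (r, x + k • z) :=
    fun r hr k => (hf.of_fderiv.continuous_slice hr).comp (by fun_prop)
  have hF'c : Continuous (F' (t, c)) :=
    (continuous_heatKernel d).smul ((hcont t ht c).clm_comp continuous_scaleMap)
  have hbound : ∀ z, ∀ q ∈ Ioo a b ×ˢ (univ : Set ℝ),
      ‖F' q z‖ ≤ B * ((1 + ‖z‖) * |heatKernel d 1 z|) := by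
    intro z q hq
    rw [hF', norm_smul, Real.norm_eq_abs]
    have h1 := hB q.1 ⟨hq.1.1.le, hq.1.2.le⟩ (x + q.2 • z)
    have h2 := (ContinuousLinearMap.opNorm_comp_le
      (fderiv ℝ f (q.1, x + q.2 • z)) (scaleMap z)).trans
      (mul_le_mul h1 (norm_scaleMap_le z) (norm_nonneg _) ((norm_nonneg _).trans h1))
    calc _ ≤ |heatKernel d 1 z| * (B * (1 + ‖z‖)) := by gcongr
      _ = _ := by ring
  have hmem : (t, c) ∈ Ioo a b ×ˢ (univ : Set ℝ) := ⟨⟨hat, hbt⟩, trivial⟩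
  have hnhds : Ioo a b ×ˢ (univ : Set ℝ) ∈ 𝓝 (t, c) :=
    (isOpen_Ioo.prod isOpen_univ).mem_nhds hmem
  have hbi : Integrable fun z => B * ((1 + ‖z‖) * |heatKernel d 1 z|) :=
    hγ.integrable_one_add_norm_mul.const_mul B
  have main := hasFDerivAt_integral_of_dominated_of_fderiv_le (𝕜 := ℝ) (μ := volume)
    (F := fun (q : ℝ × ℝ) z => f (q.1, x + q.2 • z) * heatKernel d 1 z) (F' := F')
    (x₀ := (t, c)) (bound := fun z => B * ((1 + ‖z‖) * |heatKernel d 1 z|)) hnhds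
    (by
      filter_upwards [hnhds] with q hq
      exact (hf.integrable_gaussAvg (hslab _ hq.1) hγ x q.2).aestronglyMeasurable)
    (hf.integrable_gaussAvg ht hγ x c) hF'c.aestronglyMeasurable
    (.of_forall hbound) hbi
    (.of_forall fun z q hq => by
      have h1 : HasFDerivAt (fun q : ℝ × ℝ => (q.1, x + q.2 • z)) (scaleMap z) q :=
        hasFDerivAt_fst.prodMk ((hasFDerivAt_snd.smul_const z).const_add x)
      have h2 := ((hf.differentiableAt (q := (q.1, x + q.2 • z))
        ⟨hslab _ hq.1, trivial⟩).hasFDerivAt.comp q h1).mul_const (heatKernel d 1 z)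
      exact h2)
  have hF'i : Integrable (F' (t, c)) :=
    hbi.mono' hF'c.aestronglyMeasurable (.of_forall fun z => hbound z _ hmem)
  have happ : ∀ z (p : ℝ × ℝ), F' (t, c) z p
      = p.1 * (timeDeriv f (t, x + c • z) * heatKernel d 1 z)
        + p.2 * ∑ j, (spaceDeriv j f (t, x + c • z) * (z j * heatKernel d 1 z)) := by
    intro z p
    have h1 : scaleMap z p = p.1 • ((1 : ℝ), (0 : EuclideanSpace ℝ (Fin d)))
        + p.2 • ∑ j, z j • ((0 : ℝ), EuclideanSpace.single j (1 : ℝ)) := by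
      have h3 : ∑ j, z j • EuclideanSpace.single j (1 : ℝ) = z := by
        ext k; simp [Pi.single_apply]
      simp only [scaleMap, ContinuousLinearMap.prod_apply, ContinuousLinearMap.coe_fst',
        ContinuousLinearMap.smulRight_apply, ContinuousLinearMap.coe_snd', Prod.smul_mk,
        smul_zero]
      have h4 : ∑ j, ((0 : ℝ), z j • EuclideanSpace.single j (1 : ℝ)) = ((0 : ℝ), z) := by
        rw [Prod.ext_iff]; simp [Prod.fst_sum, Prod.snd_sum, h3]
      rw [h4]; simp
    simp only [hF', smul_apply, ContinuousLinearMap.comp_apply, h1, map_add,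
      map_smul, map_sum, smul_eq_mul, timeDeriv, spaceDeriv, dirDeriv]
    rw [mul_add, Finset.mul_sum, Finset.mul_sum, Finset.mul_sum]
    congr 1
    · ring
    · exact Finset.sum_congr rfl fun j _ => by ring
  convert! main using 1
  refine ContinuousLinearMap.ext fun p => ?_
  rw [ContinuousLinearMap.integral_apply hF'i]
  simp_rw [happ]
  have hint : ∀ j, Integrable fun z =>
      spaceDeriv j f (t, x + c • z) * (z j * heatKernel d 1 z) :=
    fun j => (hf.of_spaceDeriv j).integrable_gaussAvg ht (hγ.coord j) x c
  rw [integral_add ((hf.of_timeDeriv.integrable_gaussAvg ht hγ x c).const_mul _)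
    ((integrable_finsetSum _ fun j _ => hint j).const_mul _), integral_const_mul,
    integral_const_mul, integral_finsetSum _ fun j _ => hint j]
  have hj : ∀ j, ∫ z, spaceDeriv j f (t, x + c • z) * (z j * heatKernel d 1 z)
      = 2 * c * gaussAvg (heatKernel d 1) (spaceDeriv j (spaceDeriv j f)) x t c := by
    intro j
    have h1 := (hf.of_spaceDeriv j).gaussAvg_lineDeriv (x := x) (c := c) ht hγ
      (.smul (-(1 / 2)) (hγ.coord j)) (GaussWeight.hasLineDerivAt_heatKernel j)
    have h2 : gaussAvg (fun z => -(1 / 2) * (z j * heatKernel d 1 z)) (spaceDeriv j f) x t c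
        = -(1 / 2) * ∫ z, spaceDeriv j f (t, x + c • z) * (z j * heatKernel d 1 z) := by
      rw [gaussAvg, ← integral_const_mul]
      congr 1; ext z; ring
    rw [h2] at h1
    linarith
  simp_rw [hj]
  have hl : gaussAvg (heatKernel d 1) (spaceLaplacian f) x t c
      = ∑ j, gaussAvg (heatKernel d 1) (spaceDeriv j (spaceDeriv j f)) x t c :=
    gaussAvg_sum (fun j _ => (hf.of_spaceDeriv j).of_spaceDeriv j) ht hγ
  simp only [add_apply, smul_apply,
    ContinuousLinearMap.coe_fst', ContinuousLinearMap.coe_snd', smul_eq_mul]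
  rw [hl, ← Finset.mul_sum, gaussAvg]
  ring

/-- The heat flow along a curve in time and diffusion parameter. -/
theorem SmoothPeriodic.hasDerivAt_heatFlow (hf : SmoothPeriodic T f)
    (x : EuclideanSpace ℝ (Fin d)) {θ ρ : ℝ → ℝ} {θ' ρ' r : ℝ} (hθ : HasDerivAt θ θ' r)
    (hρ : HasDerivAt ρ ρ' r) (hθr : θ r ∈ Ioo 0 T) (hρr : 0 < ρ r) :
    HasDerivAt (fun r => heatFlow f x (θ r) (ρ r))
      (θ' * heatFlow (timeDeriv f) x (θ r) (ρ r)
        + ρ' * heatFlow (spaceLaplacian f) x (θ r) (ρ r)) r := by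
  have h := (hf.hasFDerivAt_gaussAvg hθr x (√(ρ r))).comp_hasDerivAt r
    (hθ.prodMk (hρ.sqrt hρr.ne'))
  convert! h using 1
  have h0 : √(ρ r) ≠ 0 := (Real.sqrt_pos.2 hρr).ne'
  simp only [heatFlow, add_apply, smul_apply,
    ContinuousLinearMap.coe_fst', ContinuousLinearMap.coe_snd', smul_eq_mul]
  field_simp

end

/-! ### Derivative bounds for Gaussian averages -/

section

variable {d : ℕ} {T : ℝ} {f : ℝ × EuclideanSpace ℝ (Fin d) → ℝ}
  {w : EuclideanSpace ℝ (Fin d) → ℝ} {x : EuclideanSpace ℝ (Fin d)} {t s α : ℝ}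

theorem GaussWeight.exists_lineDeriv_weight (hw : GaussWeight d w) (j : Fin d) :
    ∃ w', GaussWeight d w' ∧ ∫ z, w' z = 0 ∧
      ∀ (T : ℝ) (f : ℝ × EuclideanSpace ℝ (Fin d) → ℝ) (x : EuclideanSpace ℝ (Fin d)) (t c : ℝ),
        SmoothPeriodic T f → t ∈ Ioo 0 T →
          gaussAvg w' f x t c = -(c * gaussAvg w (spaceDeriv j f) x t c) := by
  obtain ⟨w', hw', h⟩ := hw.exists_hasLineDerivAt j
  exact ⟨w', hw', hw.integral_lineDeriv_eq_zero hw' h,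
    fun T f x t c hf ht => hf.gaussAvg_lineDeriv ht hw hw' h⟩

theorem GaussWeight.sum {ι : Type*} (I : Finset ι) {w : ι → EuclideanSpace ℝ (Fin d) → ℝ}
    (hw : ∀ i ∈ I, GaussWeight d (w i)) : GaussWeight d (fun z => ∑ i ∈ I, w i z) := by
  classical
  induction I using Finset.induction_on with
  | empty => simpa using GaussWeight.base.smul (d := d) 0
  | insert i I hi ih =>
    simp_rw [Finset.sum_insert hi]
    exact (hw i (by simp)).add (ih fun k hk => hw k (by simp [hk]))

/-- The kernel representing the Laplacian of the heat flow. -/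
theorem exists_laplacian_weight (d : ℕ) :
    ∃ w, GaussWeight d w ∧ ∫ z, w z = 0 ∧
      ∀ (T : ℝ) (f : ℝ × EuclideanSpace ℝ (Fin d) → ℝ) (x : EuclideanSpace ℝ (Fin d)) (t s : ℝ),
        SmoothPeriodic T f → t ∈ Ioo 0 T → 0 < s →
          heatFlow (spaceLaplacian f) x t s = s⁻¹ * gaussAvg w f x t (√s) := by
  choose w₁ hw₁ _ h₁ using fun j => GaussWeight.base.exists_lineDeriv_weight (d := d) j
  choose w₂ hw₂ hw₂0 h₂ using fun j => (hw₁ j).exists_lineDeriv_weight j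
  refine ⟨_, GaussWeight.sum Finset.univ fun j _ => hw₂ j, ?_, fun T f x t s hf ht hs => ?_⟩
  · rw [integral_finsetSum _ fun j _ => (hw₂ j).integrable]
    simp [hw₂0]
  · have h3 : gaussAvg (fun z => ∑ j, w₂ j z) f x t (√s) = ∑ j, gaussAvg (w₂ j) f x t (√s) := by
      unfold gaussAvg
      rw [← integral_finsetSum _ fun j _ => hf.integrable_gaussAvg ht (hw₂ j) x _]
      simp_rw [Finset.mul_sum]
    rw [h3, heatFlow]
    unfold spaceLaplacian
    rw [gaussAvg_sum (fun j _ => (hf.of_spaceDeriv j).of_spaceDeriv j) ht GaussWeight.base,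
      Finset.mul_sum]
    refine Finset.sum_congr rfl fun j _ => ?_
    rw [h₂ j T f x t _ hf ht, h₁ j T _ x t _ (hf.of_spaceDeriv j) ht]
    have h4 := Real.mul_self_sqrt hs.le
    rw [show ∀ a : ℝ, -(√s * -(√s * a)) = (√s * √s) * a by intro a; ring, h4]
    field_simp

theorem GaussWeight.abs_gaussAvg_le_of_holder (hw : GaussWeight d w) (hw0 : ∫ z, w z = 0)
    (hα : 0 < α) (hα1 : α < 1) {L c B : ℝ} (hL : 0 ≤ L) (hc : 0 ≤ c)
    (hcont : Continuous fun y => f (t, y)) (hB : ∀ y, |f (t, y)| ≤ B)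
    (hhol : ∀ y, |f (t, y) - f (t, x)| ≤ L * ‖y - x‖ ^ α) :
    |gaussAvg w f x t c| ≤ L * c ^ α * ∫ z, (1 + ‖z‖) * |w z| := by
  have h1 : gaussAvg w f x t c = ∫ z, (f (t, x + c • z) - f (t, x)) * w z := by
    simp_rw [sub_mul]
    rw [integral_sub (hw.integrable_mul (g := fun z => f (t, x + c • z)) (hcont.comp
      (by fun_prop : Continuous fun z : EuclideanSpace ℝ (Fin d) => x + c • z)) fun z => hB _)
      (hw.integrable.const_mul _), integral_const_mul, hw0, mul_zero, sub_zero]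
    rfl
  rw [h1]
  exact hw.abs_integral_sub_mul_le hα hα1 hc hL x hhol

theorem SmoothPeriodic.abs_heatFlow_sub_le (hf : SmoothPeriodic T f) (ht : t ∈ Ioo 0 T)
    (hα : 0 < α) (hα1 : α < 1) {L : ℝ} (hL : 0 ≤ L)
    (hhol : ∀ y, |f (t, y) - f (t, x)| ≤ L * ‖y - x‖ ^ α) :
    |heatFlow f x t s - f (t, x)| ≤ L * √s ^ α * ∫ z, (1 + ‖z‖) * |heatKernel d 1 z| := by
  have h1 : heatFlow f x t s - f (t, x)
      = ∫ z, (f (t, x + √s • z) - f (t, x)) * heatKernel d 1 z := by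
    simp_rw [sub_mul]
    rw [integral_sub (hf.integrable_gaussAvg ht .base x _)
      (GaussWeight.base.integrable.const_mul _), integral_const_mul, integral_heatKernel, mul_one]
    rfl
  rw [h1]
  exact GaussWeight.base.abs_integral_sub_mul_le hα hα1 (Real.sqrt_nonneg _) hL x hhol

theorem exists_heatFlow_spaceDeriv_le (d : ℕ) :
    ∃ C : ℝ, 0 ≤ C ∧ ∀ (j : Fin d) (T : ℝ) (f : ℝ × EuclideanSpace ℝ (Fin d) → ℝ)
      (x : EuclideanSpace ℝ (Fin d)) (t s B : ℝ), SmoothPeriodic T f → t ∈ Ioo 0 T → 0 < s →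
        (∀ y, |f (t, y)| ≤ B) → |heatFlow (spaceDeriv j f) x t s| ≤ C * B / √s := by
  choose w hw _ h using fun j => GaussWeight.base.exists_lineDeriv_weight (d := d) j
  refine ⟨∑ j, ∫ z, (1 + ‖z‖) * |w j z|,
    Finset.sum_nonneg fun j _ => GaussWeight.integral_one_add_norm_mul_nonneg _,
    fun j T f x t s B hf ht hs hB => ?_⟩
  have hs' := Real.sqrt_pos.2 hs
  have hB0 : 0 ≤ B := (abs_nonneg _).trans (hB x)
  rw [le_div_iff₀ hs']
  have h1 := h j T f x t (√s) hf ht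
  have h2 : |heatFlow (spaceDeriv j f) x t s| * √s = |gaussAvg (w j) f x t (√s)| := by
    rw [h1, abs_neg, abs_mul, abs_of_pos hs', mul_comm]; rfl
  rw [h2]
  calc _ ≤ B * ∫ z, (1 + ‖z‖) * |w j z| := (hw j).abs_integral_mul_le fun z => hB _
    _ ≤ B * ∑ j, ∫ z, (1 + ‖z‖) * |w j z| := by
      gcongr
      exact Finset.single_le_sum (f := fun j => ∫ z, (1 + ‖z‖) * |w j z|)
        (fun j _ => GaussWeight.integral_one_add_norm_mul_nonneg _) (Finset.mem_univ j)
    _ = _ := mul_comm _ _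

theorem exists_heatFlow_spaceDeriv₃_le (d : ℕ) (hα : 0 < α) (hα1 : α < 1) :
    ∃ C : ℝ, 0 ≤ C ∧ ∀ (i j k : Fin d) (T : ℝ) (f : ℝ × EuclideanSpace ℝ (Fin d) → ℝ)
      (x : EuclideanSpace ℝ (Fin d)) (t s L : ℝ), SmoothPeriodic T f → t ∈ Ioo 0 T → 0 < s →
        0 ≤ L → (∀ y, |f (t, y) - f (t, x)| ≤ L * ‖y - x‖ ^ α) →
          |heatFlow (spaceDeriv i (spaceDeriv j (spaceDeriv k f))) x t s|
            ≤ C * L * s ^ ((α - 3) / 2) := by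
  choose w₁ hw₁ _ h₁ using fun i => GaussWeight.base.exists_lineDeriv_weight (d := d) i
  choose w₂ hw₂ _ h₂ using fun i j => (hw₁ i).exists_lineDeriv_weight j
  choose w₃ hw₃ hw₃0 h₃ using fun i j k => (hw₂ i j).exists_lineDeriv_weight k
  refine ⟨∑ a : Fin d × Fin d × Fin d, ∫ z, (1 + ‖z‖) * |w₃ a.1 a.2.1 a.2.2 z|,
    Finset.sum_nonneg fun a _ => GaussWeight.integral_one_add_norm_mul_nonneg _,
    fun i j k T f x t s L hf ht hs hL hhol => ?_⟩
  have hs' := Real.sqrt_pos.2 hs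
  set A := heatFlow (spaceDeriv i (spaceDeriv j (spaceDeriv k f))) x t s with hA
  have h1 : gaussAvg (w₃ i j k) f x t (√s) = -(√s ^ (3 : ℝ) * A) := by
    rw [h₃ i j k T f x t _ hf ht, h₂ i j T _ x t _ (hf.of_spaceDeriv k) ht,
      h₁ i T _ x t _ ((hf.of_spaceDeriv k).of_spaceDeriv j) ht, hA, heatFlow,
      show (3 : ℝ) = (3 : ℕ) by norm_num, Real.rpow_natCast]
    ring
  obtain ⟨B, hB⟩ := hf.exists_bound_slice ht
  have h2 := (hw₃ i j k).abs_gaussAvg_le_of_holder (hw₃0 i j k) hα hα1 hL hs'.le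
    (hf.continuous_slice ht) hB hhol
  rw [h1, abs_neg, abs_mul, abs_of_pos (by positivity)] at h2
  have h3 : s ^ ((α - 3) / 2) * √s ^ (3 : ℝ) = √s ^ α := by
    rw [Real.sqrt_eq_rpow, ← Real.rpow_mul hs.le, ← Real.rpow_mul hs.le, ← Real.rpow_add hs]
    congr 1; ring
  have h4 : ∫ z, (1 + ‖z‖) * |w₃ i j k z|
      ≤ ∑ a : Fin d × Fin d × Fin d, ∫ z, (1 + ‖z‖) * |w₃ a.1 a.2.1 a.2.2 z| :=
    Finset.single_le_sum
      (f := fun a : Fin d × Fin d × Fin d => ∫ z, (1 + ‖z‖) * |w₃ a.1 a.2.1 a.2.2 z|)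
      (fun a _ => GaussWeight.integral_one_add_norm_mul_nonneg _) (Finset.mem_univ (i, j, k))
  refine le_of_mul_le_mul_left ?_ (show 0 < √s ^ (3 : ℝ) by positivity)
  calc _ ≤ L * √s ^ α * ∫ z, (1 + ‖z‖) * |w₃ i j k z| := h2
    _ ≤ L * √s ^ α * ∑ a : Fin d × Fin d × Fin d, ∫ z, (1 + ‖z‖) * |w₃ a.1 a.2.1 a.2.2 z| := by
      gcongr
    _ = _ := by rw [← h3]; ring

end

theorem abs_sub_le_of_abs_deriv_le_rpow {f f' : ℝ → ℝ} {a b K L β : ℝ} (ha : 0 < a)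
    (hab : a ≤ b) (hβ : β ≠ 0) (hf : ∀ r ∈ Icc a b, HasDerivAt f (f' r) r)
    (hf' : ∀ r ∈ Icc a b, |f' r| ≤ K * r ^ (β - 1) + L) :
    |f b - f a| ≤ K / β * (b ^ β - a ^ β) + L * (b - a) := by
  have hB : ∀ r ∈ Icc a b, HasDerivAt (fun r => K / β * (r ^ β - a ^ β) + L * (r - a))
      (K * r ^ (β - 1) + L) r := by
    intro r hr
    have h1 := (((Real.hasDerivAt_rpow_const (p := β)
      (.inl (ha.trans_le hr.1).ne')).sub_const (a ^ β)).const_mul (K / β)).add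
      (((hasDerivAt_id r).sub_const a).const_mul L)
    convert! h1 using 1
    field_simp
  refine image_norm_le_of_norm_deriv_right_le_deriv_boundary' (f := fun r => f r - f a)
    (a := a) (b := b) (f' := f') (fun r hr => ((hf r hr).sub_const _).continuousAt.continuousWithinAt)
    (fun r hr => ((hf r (Ico_subset_Icc_self hr)).sub_const _).hasDerivWithinAt) (by simp)
    (fun r hr => (hB r hr).continuousAt.continuousWithinAt)
    (fun r hr => (hB r (Ico_subset_Icc_self hr)).hasDerivWithinAt)
    (fun r hr => hf' r (Ico_subset_Icc_self hr)) (right_mem_Icc.2 hab)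

/-! ### The Laplacian and the heat operator on smooth periodic functions -/

/-- The heat operator `∂ₜ - ν Δ`. -/
noncomputable def heatOp {d : ℕ} (ν : ℝ) (f : ℝ × EuclideanSpace ℝ (Fin d) → ℝ) :
    ℝ × EuclideanSpace ℝ (Fin d) → ℝ :=
  fun q => timeDeriv f q + -ν * spaceLaplacian f q

section

variable {d : ℕ} {T ν : ℝ} {f g : ℝ × EuclideanSpace ℝ (Fin d) → ℝ}

theorem spaceLaplacian_congr (h : EqOn f g (slab d T)) :
    EqOn (spaceLaplacian f) (spaceLaplacian g) (slab d T) := fun _ hq =>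
  Finset.sum_congr rfl fun _ _ => dirDeriv_congr (dirDeriv_congr h _) _ hq

theorem heatOp_congr (h : EqOn f g (slab d T)) :
    EqOn (heatOp ν f) (heatOp ν g) (slab d T) := fun q hq => by
  have h1 : timeDeriv f q = timeDeriv g q := dirDeriv_congr h _ hq
  simp only [heatOp, h1, spaceLaplacian_congr h hq]

theorem heatOp_zero (q : ℝ × EuclideanSpace ℝ (Fin d)) : heatOp ν (fun _ => 0) q = 0 := by
  have h : ∀ v, dirDeriv v (fun _ : ℝ × EuclideanSpace ℝ (Fin d) => (0 : ℝ)) = fun _ => 0 :=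
    fun v => funext fun q => by simp [dirDeriv]
  simp [heatOp, timeDeriv, spaceLaplacian, spaceDeriv, h]

namespace SmoothPeriodic

theorem of_heatOp (hf : SmoothPeriodic T f) (ν : ℝ) : SmoothPeriodic T (heatOp ν f) :=
  hf.of_timeDeriv.add (hf.of_spaceLaplacian.const_mul _)

theorem spaceLaplacian_add (hf : SmoothPeriodic T f) (hg : SmoothPeriodic T g) :
    EqOn (spaceLaplacian fun q => f q + g q)
      (fun q => spaceLaplacian f q + spaceLaplacian g q) (slab d T) := by
  intro q hq
  simp only [spaceLaplacian]
  rw [← Finset.sum_add_distrib]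
  refine Finset.sum_congr rfl fun j _ => ?_
  exact (dirDeriv_congr (hf.dirDeriv_add hg _) _ hq).trans
    ((hf.of_spaceDeriv j).dirDeriv_add (hg.of_spaceDeriv j) _ hq)

theorem spaceLaplacian_const_mul (hf : SmoothPeriodic T f) (c : ℝ) :
    EqOn (spaceLaplacian fun q => c * f q) (fun q => c * spaceLaplacian f q) (slab d T) := by
  intro q hq
  simp only [spaceLaplacian]
  rw [Finset.mul_sum]
  refine Finset.sum_congr rfl fun j _ => ?_
  exact (dirDeriv_congr (hf.dirDeriv_const_mul c _) _ hq).trans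
    ((hf.of_spaceDeriv j).dirDeriv_const_mul c _ hq)

theorem spaceLaplacian_sum {ι : Type*} {I : Finset ι}
    {f : ι → ℝ × EuclideanSpace ℝ (Fin d) → ℝ} (hf : ∀ i ∈ I, SmoothPeriodic T (f i)) :
    EqOn (spaceLaplacian fun q => ∑ i ∈ I, f i q)
      (fun q => ∑ i ∈ I, spaceLaplacian (f i) q) (slab d T) := by
  intro q hq
  simp only [spaceLaplacian]
  rw [Finset.sum_comm]
  refine Finset.sum_congr rfl fun j _ => ?_
  exact (dirDeriv_congr (dirDeriv_sum hf _) _ hq).trans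
    (dirDeriv_sum (fun i hi => (hf i hi).of_spaceDeriv j) _ hq)

theorem spaceLaplacian_dirDeriv (hf : SmoothPeriodic T f)
    (v : ℝ × EuclideanSpace ℝ (Fin d)) :
    EqOn (spaceLaplacian (dirDeriv v f)) (dirDeriv v (spaceLaplacian f)) (slab d T) := by
  intro q hq
  have h1 : dirDeriv v (spaceLaplacian f) q
      = ∑ j, dirDeriv v (spaceDeriv j (spaceDeriv j f)) q :=
    dirDeriv_sum (fun j _ => (hf.of_spaceDeriv j).of_spaceDeriv j) v hq
  rw [h1]
  refine Finset.sum_congr rfl fun j _ => ?_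
  exact (dirDeriv_congr (hf.dirDeriv_comm _ v) _ hq).trans
    ((hf.of_spaceDeriv j).dirDeriv_comm _ v hq)

theorem spaceLaplacian_heatOp (hf : SmoothPeriodic T f) (ν : ℝ) :
    EqOn (spaceLaplacian (heatOp ν f)) (heatOp ν (spaceLaplacian f)) (slab d T) := by
  intro q hq
  have h1 := hf.of_timeDeriv.spaceLaplacian_add (hf.of_spaceLaplacian.const_mul (-ν)) hq
  have h2 := hf.of_spaceLaplacian.spaceLaplacian_const_mul (-ν) hq
  have h3 := hf.spaceLaplacian_dirDeriv (1, 0) hq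
  simp only at h1 h2
  change spaceLaplacian (fun q => timeDeriv f q + -ν * spaceLaplacian f q) q = _
  rw [h1, h2]
  simp only [heatOp, timeDeriv, h3]

theorem spaceDeriv_heatOp (hf : SmoothPeriodic T f) (ν : ℝ) (i : Fin d) :
    EqOn (spaceDeriv i (heatOp ν f)) (heatOp ν (spaceDeriv i f)) (slab d T) := by
  intro q hq
  have h1 : spaceDeriv i (heatOp ν f) q
      = spaceDeriv i (timeDeriv f) q + spaceDeriv i (fun q => -ν * spaceLaplacian f q) q :=
    hf.of_timeDeriv.dirDeriv_add (hf.of_spaceLaplacian.const_mul (-ν)) _ hq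
  have h2 : spaceDeriv i (fun q => -ν * spaceLaplacian f q) q
      = -ν * spaceDeriv i (spaceLaplacian f) q :=
    hf.of_spaceLaplacian.dirDeriv_const_mul (-ν) _ hq
  have h3 : spaceLaplacian (spaceDeriv i f) q = spaceDeriv i (spaceLaplacian f) q :=
    hf.spaceLaplacian_dirDeriv _ hq
  have h4 : spaceDeriv i (timeDeriv f) q = timeDeriv (spaceDeriv i f) q := hf.dirDeriv_comm _ _ hq
  rw [h1, h2, ← h3, h4]
  rfl

theorem heatOp_sum {ι : Type*} {I : Finset ι}
    {f : ι → ℝ × EuclideanSpace ℝ (Fin d) → ℝ} (hf : ∀ i ∈ I, SmoothPeriodic T (f i)) :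
    EqOn (heatOp ν fun q => ∑ i ∈ I, f i q) (fun q => ∑ i ∈ I, heatOp ν (f i) q)
      (slab d T) := by
  intro q hq
  have h1 := dirDeriv_sum hf (1, 0) hq
  have h2 := spaceLaplacian_sum hf hq
  simp only at h1 h2
  simp only [heatOp, timeDeriv, h1, h2, Finset.sum_add_distrib, Finset.mul_sum]

end SmoothPeriodic

end

/-! ### Navier–Stokes flows -/

/-- A smooth periodic solution of the incompressible Navier–Stokes equations on the slab, given
by its velocity components and its pressure. -/
structure NavierStokesFlow {d : ℕ} (T ν : ℝ)
    (U : Fin d → ℝ × EuclideanSpace ℝ (Fin d) → ℝ)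
    (P : ℝ × EuclideanSpace ℝ (Fin d) → ℝ) : Prop where
  velocity : ∀ i, SmoothPeriodic T (U i)
  pressure : SmoothPeriodic T P
  momentum : ∀ i, ∀ q ∈ slab d T,
    timeDeriv (U i) q + ∑ j, U j q * spaceDeriv j (U i) q + spaceDeriv i P q
      = ν * spaceLaplacian (U i) q
  incompressible : ∀ q ∈ slab d T, ∑ i, spaceDeriv i (U i) q = 0

namespace NavierStokesFlow

variable {d : ℕ} {T ν : ℝ} {U : Fin d → ℝ × EuclideanSpace ℝ (Fin d) → ℝ}
  {P : ℝ × EuclideanSpace ℝ (Fin d) → ℝ}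

theorem smoothPeriodic_mul (h : NavierStokesFlow T ν U P) (i j : Fin d) :
    SmoothPeriodic T fun q => U i q * U j q :=
  (h.velocity i).mul (h.velocity j)

theorem smoothPeriodic_flux (h : NavierStokesFlow T ν U P) (i : Fin d) :
    SmoothPeriodic T fun q => ∑ j, spaceDeriv j (fun q => U i q * U j q) q :=
  .sum fun j _ => (h.smoothPeriodic_mul i j).of_spaceDeriv j

theorem heatOp_eq (h : NavierStokesFlow T ν U P) (i : Fin d) :
    EqOn (heatOp ν (U i))
      (fun q => -1 * (∑ j, spaceDeriv j (fun q => U i q * U j q) q + spaceDeriv i P q))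
      (slab d T) := by
  intro q hq
  have h1 : ∀ j, spaceDeriv j (fun q => U i q * U j q) q
      = U i q * spaceDeriv j (U j) q + U j q * spaceDeriv j (U i) q := fun j =>
    (h.velocity i).dirDeriv_mul (h.velocity j) _ hq
  have h2 := h.momentum i q hq
  simp only [heatOp, h1, Finset.sum_add_distrib, ← Finset.mul_sum, h.incompressible q hq]
  linarith

theorem sum_spaceDeriv_heatOp (h : NavierStokesFlow T ν U P) :
    ∀ q ∈ slab d T, ∑ i, spaceDeriv i (heatOp ν (U i)) q = 0 := by
  intro q hq
  have h1 : ∀ i, spaceDeriv i (heatOp ν (U i)) q = heatOp ν (spaceDeriv i (U i)) q :=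
    fun i => (h.velocity i).spaceDeriv_heatOp ν i hq
  have h2 := SmoothPeriodic.heatOp_sum (ν := ν) (I := Finset.univ)
    (fun i _ => (h.velocity i).of_spaceDeriv i) hq
  simp only at h2
  have h3 := heatOp_congr (ν := ν) (show EqOn (fun q => ∑ i, spaceDeriv i (U i) q) (fun _ => 0)
    (slab d T) from h.incompressible) hq
  simp_rw [h1]
  rw [← h2, h3, heatOp_zero]

theorem spaceLaplacian_pressure (h : NavierStokesFlow T ν U P) :
    EqOn (spaceLaplacian P)
      (fun q => -1 * ∑ k, ∑ j, spaceDeriv k (spaceDeriv j fun q => U k q * U j q) q)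
      (slab d T) := by
  intro q hq
  have h1 : ∀ k, spaceDeriv k (heatOp ν (U k)) q
      = -1 * (∑ j, spaceDeriv k (spaceDeriv j fun q => U k q * U j q) q
        + spaceDeriv k (spaceDeriv k P) q) := by
    intro k
    have e1 := dirDeriv_congr (h.heatOp_eq k) (0, EuclideanSpace.single k 1) hq
    have e2 := ((h.smoothPeriodic_flux k).add (h.pressure.of_spaceDeriv k)).dirDeriv_const_mul
      (-1) (0, EuclideanSpace.single k 1) hq
    have e3 := (h.smoothPeriodic_flux k).dirDeriv_add (h.pressure.of_spaceDeriv k)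
      (0, EuclideanSpace.single k 1) hq
    have e4 := SmoothPeriodic.dirDeriv_sum (s := Finset.univ)
      (fun j _ => (h.smoothPeriodic_mul k j).of_spaceDeriv j) (0, EuclideanSpace.single k 1) hq
    simp only at e2 e3 e4
    rw [e2, e3, e4] at e1
    exact e1
  have h2 := h.sum_spaceDeriv_heatOp q hq
  simp_rw [h1] at h2
  rw [← Finset.mul_sum, Finset.sum_add_distrib] at h2
  have h3 : spaceLaplacian P q = ∑ k, spaceDeriv k (spaceDeriv k P) q := rfl
  rw [h3]
  linarith

/-- The Laplacian of the force is a third-order expression in `U ⊗ U` without the pressure. -/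
theorem spaceLaplacian_heatOp_eq (h : NavierStokesFlow T ν U P) (i : Fin d) :
    EqOn (spaceLaplacian (heatOp ν (U i)))
      (fun q =>
        ∑ k, ∑ j, spaceDeriv i (spaceDeriv k (spaceDeriv j fun q => U k q * U j q)) q
          + -1 * ∑ k, ∑ j, spaceDeriv k (spaceDeriv k (spaceDeriv j fun q => U i q * U j q)) q)
      (slab d T) := by
  intro q hq
  have hQ := fun i j k l => ((h.smoothPeriodic_mul i j).of_spaceDeriv k).of_spaceDeriv l
  have e1 := spaceLaplacian_congr (h.heatOp_eq i) hq
  have e2 := ((h.smoothPeriodic_flux i).add (h.pressure.of_spaceDeriv i)).spaceLaplacian_const_mul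
    (-1) hq
  have e3 := (h.smoothPeriodic_flux i).spaceLaplacian_add (h.pressure.of_spaceDeriv i) hq
  have e4 : spaceLaplacian (spaceDeriv i P) q = spaceDeriv i (spaceLaplacian P) q :=
    h.pressure.spaceLaplacian_dirDeriv _ hq
  have e5 := dirDeriv_congr h.spaceLaplacian_pressure (0, EuclideanSpace.single i 1) hq
  have e6 := (SmoothPeriodic.sum (s := Finset.univ) fun k _ => .sum (s := Finset.univ)
    fun j _ => hQ k j j k).dirDeriv_const_mul (-1) (0, EuclideanSpace.single i 1) hq
  have e7 := SmoothPeriodic.dirDeriv_sum (s := Finset.univ) (fun k _ => .sum (s := Finset.univ)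
    fun j _ => hQ k j j k) (0, EuclideanSpace.single i 1) hq
  have e8 := fun k => SmoothPeriodic.dirDeriv_sum (s := Finset.univ)
    (fun j _ => hQ k j j k) (0, EuclideanSpace.single i 1) hq
  have e9 := SmoothPeriodic.spaceLaplacian_sum (I := Finset.univ)
    (fun j _ => (h.smoothPeriodic_mul i j).of_spaceDeriv j) hq
  simp only at e2 e3 e6 e7 e8 e9
  simp_rw [e8] at e7
  rw [e7] at e6
  rw [e6] at e5
  change spaceDeriv i (spaceLaplacian P) q = _ at e5
  rw [e1, e2, e3, e4, e5, e9]
  simp only [spaceLaplacian, spaceDeriv]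
  rw [Finset.sum_comm (γ := Fin d) (f := fun j k => dirDeriv (0, EuclideanSpace.single k 1)
    (dirDeriv (0, EuclideanSpace.single k 1) (dirDeriv (0, EuclideanSpace.single j 1)
      fun q => U i q * U j q)) q)]
  ring

end NavierStokesFlow

/-! ### The heat flow along smooth solutions -/

section

variable {d : ℕ} {T ν α K L : ℝ} {f : ℝ × EuclideanSpace ℝ (Fin d) → ℝ}
  {x : EuclideanSpace ℝ (Fin d)} {t s : ℝ}

theorem SmoothPeriodic.heatFlow_heatOp (hf : SmoothPeriodic T f) (ν : ℝ) (ht : t ∈ Ioo 0 T) :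
    heatFlow (heatOp ν f) x t s
      = heatFlow (timeDeriv f) x t s + -ν * heatFlow (spaceLaplacian f) x t s := by
  unfold heatFlow
  rw [← gaussAvg_const_mul, ← gaussAvg_add hf.of_timeDeriv (hf.of_spaceLaplacian.const_mul _) ht
    GaussWeight.base]
  rfl

theorem div_half_sub_one (K α : ℝ) : K / ((α - 1) / 2) = -(2 * K / (1 - α)) := by
  rw [div_div_eq_mul_div, ← div_neg, neg_sub, mul_comm]

/-- A bound on the Laplacian integrates to a bound on a heat flow that decays at infinity. -/
theorem SmoothPeriodic.abs_heatFlow_le_of_tendsto (hf : SmoothPeriodic T f) (hα1 : α < 1)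
    (hK : 0 ≤ K) (ht : t ∈ Ioo 0 T) (hs : 0 < s)
    (hlap : ∀ σ, 0 < σ → |heatFlow (spaceLaplacian f) x t σ| ≤ K * σ ^ ((α - 3) / 2))
    (hlim : Tendsto (fun σ => heatFlow f x t σ) atTop (𝓝 0)) :
    |heatFlow f x t s| ≤ 2 * K / (1 - α) * s ^ ((α - 1) / 2) := by
  have h1 : ∀ᶠ S in atTop, |heatFlow f x t S - heatFlow f x t s|
      ≤ 2 * K / (1 - α) * s ^ ((α - 1) / 2) := by
    filter_upwards [eventually_ge_atTop s] with S hS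
    have h2 := abs_sub_le_of_abs_deriv_le_rpow (K := K) (L := 0) (β := (α - 1) / 2)
      (f := fun σ => heatFlow f x t σ) (f' := fun σ => heatFlow (spaceLaplacian f) x t σ) hs hS
      (by linarith) (fun r hr => by
        simpa using hf.hasDerivAt_heatFlow x (hasDerivAt_const r t) (hasDerivAt_id r) ht
          (hs.trans_le hr.1))
      (fun r hr => by
        rw [add_zero, show (α - 1) / 2 - 1 = (α - 3) / 2 by ring]
        exact hlap r (hs.trans_le hr.1))
    refine h2.trans ?_
    have h3 : 0 ≤ 2 * K / (1 - α) * S ^ ((α - 1) / 2) := by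
      have := sub_pos.2 hα1
      have := hs.trans_le hS
      positivity
    rw [div_half_sub_one]
    linarith
  have h5 : Tendsto (fun S => |heatFlow f x t S - heatFlow f x t s|) atTop
      (𝓝 |heatFlow f x t s|) := by
    simpa using (hlim.sub_const (heatFlow f x t s)).abs
  exact le_of_tendsto h5 h1

/-- Following the heat flow backwards in time along the characteristics of the heat operator. -/
theorem SmoothPeriodic.mul_abs_heatFlow_spaceLaplacian_le (hf : SmoothPeriodic T f) (hν : 0 < ν)
    (hα1 : α < 1) (hK : 0 ≤ K) (hs : 0 < s) {t₀ : ℝ} (ht₀ : 0 < t₀) (htt : t₀ ≤ t) (htT : t < T)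
    (hlap : ∀ t ∈ Ioo 0 T, ∀ σ, 0 < σ →
      |heatFlow (spaceLaplacian (heatOp ν f)) x t σ| ≤ K * σ ^ ((α - 3) / 2)) :
    ν * |heatFlow (spaceLaplacian f) x t s| ≤ 2 * K / (1 - α) * s ^ ((α - 1) / 2)
      + ν * |heatFlow (spaceLaplacian f) x t₀ (s + ν * (t - t₀))| := by
  have hS : s ≤ s + ν * (t - t₀) := by nlinarith
  have hθ : ∀ r ∈ Icc s (s + ν * (t - t₀)), t - (r - s) / ν ∈ Ioo 0 T := by
    intro r hr
    have h1 : (r - s) / ν ≤ t - t₀ := by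
      rw [div_le_iff₀ hν]
      linarith [hr.2]
    have h2 : 0 ≤ (r - s) / ν := div_nonneg (by linarith [hr.1]) hν.le
    exact ⟨by linarith, by linarith⟩
  have hlap' : ∀ r ∈ Icc s (s + ν * (t - t₀)),
      heatFlow (spaceLaplacian (heatOp ν f)) x (t - (r - s) / ν) r
        = heatFlow (timeDeriv (spaceLaplacian f)) x (t - (r - s) / ν) r
          + -ν * heatFlow (spaceLaplacian (spaceLaplacian f)) x (t - (r - s) / ν) r :=
    fun r hr => (gaussAvg_congr (hf.spaceLaplacian_heatOp ν) (hθ r hr)).trans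
      (hf.of_spaceLaplacian.heatFlow_heatOp ν (hθ r hr))
  have h2 := abs_sub_le_of_abs_deriv_le_rpow (K := K / ν) (L := 0) (β := (α - 1) / 2)
    (f := fun r => heatFlow (spaceLaplacian f) x (t - (r - s) / ν) r)
    (f' := fun r => -(1 / ν) * heatFlow (spaceLaplacian (heatOp ν f)) x (t - (r - s) / ν) r) hs hS
    (by linarith) (fun r hr => by
      have h3 := hf.of_spaceLaplacian.hasDerivAt_heatFlow x
        ((((hasDerivAt_id r).sub_const s).div_const ν).const_sub t) (hasDerivAt_id r) (hθ r hr)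
        (hs.trans_le hr.1)
      convert! h3 using 1
      simp only [id]
      rw [hlap' r hr]
      field_simp
      ring)
    (fun r hr => by
      rw [add_zero, show (α - 1) / 2 - 1 = (α - 3) / 2 by ring, abs_mul, abs_neg,
        abs_of_pos (by positivity)]
      calc _ ≤ 1 / ν * (K * r ^ ((α - 3) / 2)) := by
            gcongr
            exact hlap _ (hθ r hr) r (hs.trans_le hr.1)
        _ = _ := by ring)
  simp only [sub_self, zero_div, sub_zero, zero_mul, add_zero] at h2
  rw [show t - (s + ν * (t - t₀) - s) / ν = t₀ by field_simp; ring] at h2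
  have h3 : 0 ≤ 2 * K / (1 - α) * (s + ν * (t - t₀)) ^ ((α - 1) / 2) := by
    have := sub_pos.2 hα1
    have := hs.trans_le hS
    positivity
  have h4 : ν * (K / ν / ((α - 1) / 2) * ((s + ν * (t - t₀)) ^ ((α - 1) / 2) - s ^ ((α - 1) / 2)))
      = -(2 * K / (1 - α)) * ((s + ν * (t - t₀)) ^ ((α - 1) / 2) - s ^ ((α - 1) / 2)) := by
    rw [← mul_assoc, mul_div_assoc', mul_div_cancel₀ _ hν.ne', div_half_sub_one]
  have h6 := mul_le_mul_of_nonneg_left h2 hν.le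
  rw [h4] at h6
  have h7 : |heatFlow (spaceLaplacian f) x t s|
      ≤ |heatFlow (spaceLaplacian f) x t₀ (s + ν * (t - t₀)) - heatFlow (spaceLaplacian f) x t s|
        + |heatFlow (spaceLaplacian f) x t₀ (s + ν * (t - t₀))| := by
    have := abs_sub_abs_le_abs_sub (heatFlow (spaceLaplacian f) x t s)
      (heatFlow (spaceLaplacian f) x t₀ (s + ν * (t - t₀)))
    rw [abs_sub_comm] at this
    linarith
  have h8 := mul_le_mul_of_nonneg_left h7 hν.le
  linarith

theorem GaussWeight.tendsto_gaussAvg {w : EuclideanSpace ℝ (Fin d) → ℝ} (hw : GaussWeight d w)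
    (hT : 0 < T) {B : ℝ} (hf : ContinuousOn f (Ico 0 T ×ˢ univ))
    (hB : ∀ t ∈ Ico 0 T, ∀ y, |f (t, y)| ≤ B) (x : EuclideanSpace ℝ (Fin d)) {c : ℝ → ℝ}
    (hc : Tendsto c (𝓝[>] 0) (𝓝 (c 0))) :
    Tendsto (fun r => gaussAvg w f x r (c r)) (𝓝[>] 0) (𝓝 (gaussAvg w f x 0 (c 0))) := by
  have hev : ∀ᶠ r : ℝ in 𝓝[>] 0, r ∈ Ico 0 T := by
    filter_upwards [Ioo_mem_nhdsGT hT] with r hr using ⟨hr.1.le, hr.2⟩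
  have hslice : ∀ r ∈ Ico 0 T, Continuous fun y => f (r, y) := fun r hr =>
    hf.comp_continuous (by fun_prop) fun y => ⟨hr, trivial⟩
  refine tendsto_integral_filter_of_dominated_convergence (fun z => B * |w z|) ?_ ?_
    (hw.integrable.abs.const_mul B) ?_
  · filter_upwards [hev] with r hr
    exact (((hslice r hr).comp
      (by fun_prop : Continuous fun z : EuclideanSpace ℝ (Fin d) => x + c r • z)).mul
        hw.continuous).aestronglyMeasurable
  · filter_upwards [hev] with r hr
    refine .of_forall fun z => ?_
    rw [norm_mul, Real.norm_eq_abs, Real.norm_eq_abs]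
    gcongr
    exact hB r hr _
  · refine .of_forall fun z => Tendsto.mul_const _ ?_
    refine (hf (0, x + c 0 • z) ⟨⟨le_rfl, hT⟩, trivial⟩).tendsto.comp ?_
    refine tendsto_nhdsWithin_iff.2 ⟨?_, hev.mono fun r hr => ⟨hr, trivial⟩⟩
    exact (tendsto_nhdsWithin_of_tendsto_nhds tendsto_id).prodMk_nhds
      ((hc.smul_const z).const_add x)

theorem exists_mul_abs_heatFlow_spaceLaplacian_le (d : ℕ) (hα : 0 < α) (hα1 : α < 1) :
    ∃ C : ℝ, 0 ≤ C ∧ ∀ (T ν K N B : ℝ) (f : ℝ × EuclideanSpace ℝ (Fin d) → ℝ)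
      (x : EuclideanSpace ℝ (Fin d)), SmoothPeriodic T f → 0 < ν → 0 ≤ K → 0 ≤ N →
      ContinuousOn f (Ico 0 T ×ˢ univ) → (∀ t ∈ Ico 0 T, ∀ y, |f (t, y)| ≤ B) →
      (∀ y, |f (0, y) - f (0, x)| ≤ N * ‖y - x‖ ^ α) →
      (∀ t ∈ Ioo 0 T, ∀ σ, 0 < σ →
        |heatFlow (spaceLaplacian (heatOp ν f)) x t σ| ≤ K * σ ^ ((α - 3) / 2)) →
      ∀ t ∈ Ioo 0 T, ∀ s, 0 < s →
        ν * |heatFlow (spaceLaplacian f) x t s| ≤ 2 * K / (1 - α) * s ^ ((α - 1) / 2)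
          + ν * (C * N * (s + ν * t) ^ (α / 2 - 1)) := by
  obtain ⟨w, hw, hw0, h⟩ := exists_laplacian_weight d
  refine ⟨∫ z, (1 + ‖z‖) * |w z|, GaussWeight.integral_one_add_norm_mul_nonneg _,
    fun T ν K N B f x hf hν hK hN hcont hB hhol hlap t ht s hs => ?_⟩
  have hT := ht.1.trans ht.2
  have hst : 0 < s + ν * t := add_pos hs (mul_pos hν ht.1)
  have h1 : ∀ᶠ r in 𝓝[>] 0, ν * |heatFlow (spaceLaplacian f) x t s|
      ≤ 2 * K / (1 - α) * s ^ ((α - 1) / 2)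
        + ν * |(s + ν * (t - r))⁻¹ * gaussAvg w f x r (√(s + ν * (t - r)))| := by
    filter_upwards [Ioo_mem_nhdsGT ht.1] with r hr
    have hr' : 0 < s + ν * (t - r) := add_pos hs (mul_pos hν (sub_pos.2 hr.2))
    rw [← h T f x r _ hf ⟨hr.1, hr.2.trans ht.2⟩ hr']
    exact hf.mul_abs_heatFlow_spaceLaplacian_le hν hα1 hK hs hr.1 hr.2.le ht.2 hlap
  have hc : ∀ c : ℝ → ℝ, Continuous c → Tendsto c (𝓝[>] 0) (𝓝 (c 0)) := fun c hc =>
    tendsto_nhdsWithin_of_tendsto_nhds hc.continuousAt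
  have h2 : Tendsto (fun r => (s + ν * (t - r))⁻¹ * gaussAvg w f x r (√(s + ν * (t - r))))
      (𝓝[>] 0) (𝓝 ((s + ν * (t - 0))⁻¹ * gaussAvg w f x 0 (√(s + ν * (t - 0))))) :=
    ((hc (fun r => s + ν * (t - r)) (by fun_prop)).inv₀ (by simpa using hst.ne')).mul
      (hw.tendsto_gaussAvg hT hcont hB x (c := fun r => √(s + ν * (t - r)))
        (hc (fun r => √(s + ν * (t - r))) (by fun_prop)))
  have h3 := ge_of_tendsto ((h2.abs.const_mul ν).const_add _) h1
  rw [sub_zero] at h3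
  refine h3.trans ?_
  have h4 := hw.abs_gaussAvg_le_of_holder (x := x) (f := f) (t := 0) hw0 hα hα1 hN
    (Real.sqrt_nonneg (s + ν * t))
    (hcont.comp_continuous (by fun_prop) fun y => ⟨⟨le_rfl, hT⟩, trivial⟩) (hB 0 ⟨le_rfl, hT⟩) hhol
  have h5 : (s + ν * t)⁻¹ * √(s + ν * t) ^ α = (s + ν * t) ^ (α / 2 - 1) := by
    rw [Real.sqrt_eq_rpow, ← Real.rpow_mul hst.le, ← Real.rpow_neg_one, ← Real.rpow_add hst]
    congr 1
    ring
  gcongr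
  rw [abs_mul, abs_of_pos (inv_pos.2 hst), ← h5]
  calc _ ≤ (s + ν * t)⁻¹ * (N * √(s + ν * t) ^ α * ∫ z, (1 + ‖z‖) * |w z|) := by gcongr
    _ = _ := by ring

end
namespace NavierStokesFlow

section

variable {d : ℕ} {T ν α : ℝ} {U : Fin d → ℝ × EuclideanSpace ℝ (Fin d) → ℝ}
  {P : ℝ × EuclideanSpace ℝ (Fin d) → ℝ}

theorem exists_heatFlow_spaceLaplacian_heatOp_le (d : ℕ) (hα : 0 < α) (hα1 : α < 1) :
    ∃ C : ℝ, 0 ≤ C ∧ ∀ (T ν L : ℝ) (U : Fin d → ℝ × EuclideanSpace ℝ (Fin d) → ℝ)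
      (P : ℝ × EuclideanSpace ℝ (Fin d) → ℝ) (i : Fin d) (x : EuclideanSpace ℝ (Fin d)) (t s : ℝ),
      NavierStokesFlow T ν U P → t ∈ Ioo 0 T → 0 < s → 0 ≤ L →
      (∀ j k y, |U j (t, y) * U k (t, y) - U j (t, x) * U k (t, x)| ≤ L * ‖y - x‖ ^ α) →
        |heatFlow (spaceLaplacian (heatOp ν (U i))) x t s| ≤ C * L * s ^ ((α - 3) / 2) := by
  obtain ⟨C, hC, hbd⟩ := exists_heatFlow_spaceDeriv₃_le d hα hα1
  refine ⟨d * (d * C) + d * (d * C), by positivity, fun T ν L U P i x t s h ht hs hL hhol => ?_⟩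
  have hQ := fun i j k l m =>
    (((h.smoothPeriodic_mul i j).of_spaceDeriv k).of_spaceDeriv l).of_spaceDeriv m
  have hbase := GaussWeight.base (d := d)
  have h1 := gaussAvg_congr (w := heatKernel d 1) (x := x) (c := √s)
    (h.spaceLaplacian_heatOp_eq i) ht
  have h2 := gaussAvg_add (x := x) (c := √s)
    (.sum (s := Finset.univ) fun k _ => .sum (s := Finset.univ) fun j _ => hQ k j j k i)
    ((SmoothPeriodic.sum (s := Finset.univ) fun k _ => .sum (s := Finset.univ)
      fun j _ => hQ i j j k k).const_mul (-1)) ht hbase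
  have h3 := gaussAvg_sum (x := x) (c := √s) (I := Finset.univ)
    (fun k _ => .sum (s := Finset.univ) fun j _ => hQ k j j k i) ht hbase
  have h4 := fun k => gaussAvg_sum (x := x) (c := √s) (I := Finset.univ)
    (fun j _ => hQ k j j k i) ht hbase
  have h5 := gaussAvg_sum (x := x) (c := √s) (I := Finset.univ)
    (fun k _ => .sum (s := Finset.univ) fun j _ => hQ i j j k k) ht hbase
  have h6 := fun k => gaussAvg_sum (x := x) (c := √s) (I := Finset.univ)
    (fun j _ => hQ i j j k k) ht hbase
  have h7 : ∀ g : Fin d → Fin d → ℝ, (∀ k j, |g k j| ≤ C * L * s ^ ((α - 3) / 2)) →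
      |∑ k, ∑ j, g k j| ≤ d * (d * (C * L * s ^ ((α - 3) / 2))) := by
    intro g hg
    calc |∑ k, ∑ j, g k j| ≤ ∑ k, ∑ j, |g k j| :=
          (Finset.abs_sum_le_sum_abs _ _).trans
            (Finset.sum_le_sum fun k _ => Finset.abs_sum_le_sum_abs _ _)
      _ ≤ ∑ _k : Fin d, ∑ _j : Fin d, C * L * s ^ ((α - 3) / 2) := by
          gcongr
          exact hg _ _
      _ = _ := by simp
  unfold heatFlow
  rw [h1, h2, gaussAvg_const_mul, h3, h5]
  simp_rw [h4, h6]
  refine (abs_add_le _ _).trans ?_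
  rw [abs_mul, abs_neg, abs_one, one_mul]
  calc _ ≤ _ := add_le_add
        (h7 _ fun k j => hbd i k j T _ x t s L (h.smoothPeriodic_mul k j) ht hs hL (hhol k j))
        (h7 _ fun k j => hbd k k j T _ x t s L (h.smoothPeriodic_mul i j) ht hs hL (hhol i j))
    _ = _ := by ring

theorem tendsto_heatFlow_heatOp (h : NavierStokesFlow T ν U P) (i : Fin d)
    (x : EuclideanSpace ℝ (Fin d)) {t : ℝ} (ht : t ∈ Ioo 0 T) :
    Tendsto (fun s => heatFlow (heatOp ν (U i)) x t s) atTop (𝓝 0) := by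
  obtain ⟨C, hC, hbd⟩ := exists_heatFlow_spaceDeriv_le d
  have hdecay : ∀ (j : Fin d) {f : ℝ × EuclideanSpace ℝ (Fin d) → ℝ}, SmoothPeriodic T f →
      Tendsto (fun s => heatFlow (spaceDeriv j f) x t s) atTop (𝓝 0) := by
    intro j f hf
    obtain ⟨B, hB⟩ := hf.exists_bound_slice ht
    refine squeeze_zero_norm' (a := fun s => C * B / √s) ?_ ?_
    · filter_upwards [eventually_gt_atTop 0] with s hs
      exact hbd j T f x t s B hf ht hs hB
    · exact Real.tendsto_sqrt_atTop.const_div_atTop _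
  have h1 : ∀ s, heatFlow (heatOp ν (U i)) x t s
      = -1 * (∑ j, heatFlow (spaceDeriv j fun q => U i q * U j q) x t s
        + heatFlow (spaceDeriv i P) x t s) := by
    intro s
    unfold heatFlow
    rw [gaussAvg_congr (h.heatOp_eq i) ht, gaussAvg_const_mul, gaussAvg_add
      (h.smoothPeriodic_flux i) (h.pressure.of_spaceDeriv i) ht .base,
      gaussAvg_sum (fun j _ => (h.smoothPeriodic_mul i j).of_spaceDeriv j) ht .base]
  simp_rw [h1]
  have h2 := ((tendsto_finsetSum Finset.univ fun j _ => hdecay j (h.smoothPeriodic_mul i j)).add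
    (hdecay i h.pressure)).const_mul (-1)
  simpa using h2

/-- Time increments of the mollified velocity. -/
theorem exists_abs_heatFlow_sub_heatFlow_le (d : ℕ) (hα : 0 < α) (hα1 : α < 1) :
    ∃ C : ℝ, 0 ≤ C ∧ ∀ (T ν a L N B : ℝ) (U : Fin d → ℝ × EuclideanSpace ℝ (Fin d) → ℝ)
      (P : ℝ × EuclideanSpace ℝ (Fin d) → ℝ) (i : Fin d) (x : EuclideanSpace ℝ (Fin d)),
      NavierStokesFlow T ν U P → 0 < ν → 0 < a → 0 ≤ L → 0 ≤ N →
      ContinuousOn (U i) (Ico 0 T ×ˢ univ) → (∀ t ∈ Ico 0 T, ∀ y, |U i (t, y)| ≤ B) →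
      (∀ y, |U i (0, y) - U i (0, x)| ≤ N * ‖y - x‖ ^ α) →
      (∀ t ∈ Ioo 0 T, ∀ j k y,
        |U j (t, y) * U k (t, y) - U j (t, x) * U k (t, x)| ≤ L * ‖y - x‖ ^ α) →
      ∀ t₁ t₂ s, a * ν < t₁ → t₁ ≤ t₂ → t₂ < T → 0 < s →
        |heatFlow (U i) x t₂ s - heatFlow (U i) x t₁ s|
          ≤ C * (a ^ (-α / 2) * N * (t₂ - t₁) ^ α + L * s ^ ((α - 1) / 2) * (t₂ - t₁)) := by
  obtain ⟨C₁, hC₁, h₁⟩ := exists_heatFlow_spaceLaplacian_heatOp_le d hα hα1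
  obtain ⟨C₂, hC₂, h₂⟩ := exists_mul_abs_heatFlow_spaceLaplacian_le d hα hα1
  have h1α := sub_pos.2 hα1
  refine ⟨C₂ / α + 2 * (2 * C₁ / (1 - α)), by positivity,
    fun T ν a L N B U P i x h hν ha hL hN hcont hB hhol hholQ t₁ t₂ s ht₁ htt ht₂ hs => ?_⟩
  have hlap : ∀ t ∈ Ioo 0 T, ∀ σ, 0 < σ →
      |heatFlow (spaceLaplacian (heatOp ν (U i))) x t σ| ≤ C₁ * L * σ ^ ((α - 3) / 2) :=
    fun t ht σ hσ => h₁ T ν L U P i x t σ h ht hσ hL (hholQ t ht)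
  have ht₁0 : 0 < t₁ := (mul_pos ha hν).trans ht₁
  have hslab : ∀ r ∈ Icc t₁ t₂, r ∈ Ioo 0 T := fun r hr =>
    ⟨ht₁0.trans_le hr.1, hr.2.trans_lt ht₂⟩
  set E := 2 * (C₁ * L) / (1 - α) * s ^ ((α - 1) / 2) with hE
  have hderiv : ∀ r ∈ Icc t₁ t₂,
      |heatFlow (timeDeriv (U i)) x r s| ≤ C₂ * (a ^ (-α / 2) * N) * r ^ (α - 1) + 2 * E := by
    intro r hr
    have hr0 := hslab r hr
    have e1 := (h.velocity i).of_heatOp ν |>.abs_heatFlow_le_of_tendsto hα1 (mul_nonneg hC₁ hL)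
      hr0 hs (hlap r hr0) (h.tendsto_heatFlow_heatOp i x hr0)
    have e2 := h₂ T ν (C₁ * L) N B (U i) x (h.velocity i) hν (mul_nonneg hC₁ hL) hN hcont hB hhol
      hlap r hr0 s hs
    have e3 := (h.velocity i).heatFlow_heatOp (x := x) (s := s) ν hr0
    have e4 : ν * (s + ν * r) ^ (α / 2 - 1) ≤ a ^ (-α / 2) * r ^ (α - 1) := by
      have hνr : 0 < ν * r := mul_pos hν hr0.1
      have har : a ≤ r / ν := (le_div_iff₀ hν).2 (ht₁.le.trans hr.1)
      calc ν * (s + ν * r) ^ (α / 2 - 1) ≤ ν * (ν * r) ^ (α / 2 - 1) := by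
            gcongr ν * ?_
            exact Real.rpow_le_rpow_of_nonpos hνr (le_add_of_nonneg_left hs.le) (by linarith)
        _ = (r / ν) ^ (-α / 2) * r ^ (α - 1) := by
            rw [Real.mul_rpow hν.le hr0.1.le, Real.div_rpow hr0.1.le hν.le, neg_div,
              Real.rpow_neg hν.le, div_inv_eq_mul, ← mul_assoc]
            nth_rewrite 1 [← Real.rpow_one ν]
            rw [← Real.rpow_add hν, mul_right_comm, ← Real.rpow_add hr0.1, mul_comm]
            congr 2 <;> ring
        _ ≤ _ := mul_le_mul_of_nonneg_right
            (Real.rpow_le_rpow_of_nonpos ha har (by linarith)) (Real.rpow_nonneg hr0.1.le _)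
    have e5 : ν * (C₂ * N * (s + ν * r) ^ (α / 2 - 1))
        ≤ C₂ * (a ^ (-α / 2) * N) * r ^ (α - 1) := by
      calc _ = C₂ * N * (ν * (s + ν * r) ^ (α / 2 - 1)) := by ring
        _ ≤ C₂ * N * (a ^ (-α / 2) * r ^ (α - 1)) := by gcongr
        _ = _ := by ring
    have e6 : heatFlow (timeDeriv (U i)) x r s = heatFlow (heatOp ν (U i)) x r s
        + ν * heatFlow (spaceLaplacian (U i)) x r s := by linarith
    rw [e6]
    refine (abs_add_le _ _).trans ?_
    rw [abs_mul, abs_of_pos hν]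
    linarith
  have hmain := abs_sub_le_of_abs_deriv_le_rpow (f := fun r => heatFlow (U i) x r s)
    (f' := fun r => heatFlow (timeDeriv (U i)) x r s) ht₁0 htt hα.ne' (fun r hr => by
      simpa using (h.velocity i).hasDerivAt_heatFlow x (hasDerivAt_id r) (hasDerivAt_const r s)
        (hslab r hr) hs) hderiv
  have e7 : t₂ ^ α - t₁ ^ α ≤ (t₂ - t₁) ^ α := by
    have := Real.rpow_add_le_add_rpow (sub_nonneg.2 htt) ht₁0.le hα.le hα1.le
    rw [sub_add_cancel] at this
    linarith
  have hA : 0 ≤ a ^ (-α / 2) * N := by positivity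
  have hτ : 0 ≤ t₂ - t₁ := sub_nonneg.2 htt
  have hτα : 0 ≤ (t₂ - t₁) ^ α := Real.rpow_nonneg hτ _
  have hE' : 0 ≤ L * s ^ ((α - 1) / 2) * (t₂ - t₁) := by positivity
  calc _ ≤ _ := hmain
    _ ≤ C₂ * (a ^ (-α / 2) * N) / α * (t₂ - t₁) ^ α + 2 * E * (t₂ - t₁) := by gcongr
    _ = C₂ / α * (a ^ (-α / 2) * N * (t₂ - t₁) ^ α)
        + 2 * (2 * C₁ / (1 - α)) * (L * s ^ ((α - 1) / 2) * (t₂ - t₁)) := by rw [hE]; ring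
    _ ≤ (C₂ / α + 2 * (2 * C₁ / (1 - α))) * (a ^ (-α / 2) * N * (t₂ - t₁) ^ α)
        + (C₂ / α + 2 * (2 * C₁ / (1 - α))) * (L * s ^ ((α - 1) / 2) * (t₂ - t₁)) := by
      gcongr
      · exact le_add_of_nonneg_right (by positivity)
      · exact le_add_of_nonneg_left (by positivity)
    _ = _ := by ring

/-- Hölder continuity in time of the velocity components. -/
theorem exists_abs_velocity_sub_le (d : ℕ) (hα : 0 < α) (hα1 : α < 1) :
    ∃ C : ℝ, 0 ≤ C ∧ ∀ (T ν a M₀ M₁ N : ℝ) (U : Fin d → ℝ × EuclideanSpace ℝ (Fin d) → ℝ)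
      (P : ℝ × EuclideanSpace ℝ (Fin d) → ℝ) (i : Fin d) (x : EuclideanSpace ℝ (Fin d)),
      NavierStokesFlow T ν U P → 0 < ν → 0 < a → 0 ≤ M₁ → 0 ≤ N →
      ContinuousOn (U i) (Ico 0 T ×ˢ univ) → (∀ j, ∀ t ∈ Ico 0 T, ∀ y, |U j (t, y)| ≤ M₀) →
      (∀ y, |U i (0, y) - U i (0, x)| ≤ N * ‖y - x‖ ^ α) →
      (∀ j, ∀ t ∈ Ico 0 T, ∀ y, |U j (t, y) - U j (t, x)| ≤ M₁ * ‖y - x‖ ^ α) →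
      ∀ t₁ t₂, a * ν < t₁ → t₁ ≤ t₂ → t₂ < T →
        |U i (t₂, x) - U i (t₁, x)|
          ≤ C * (M₀ ^ α * M₁ + a ^ (-α / 2) * N) * (t₂ - t₁) ^ α := by
  obtain ⟨C, hC, hbd⟩ := exists_abs_heatFlow_sub_heatFlow_le d hα hα1
  set G := ∫ z, (1 + ‖z‖) * |heatKernel d 1 z| with hG
  have hG0 : 0 ≤ G := GaussWeight.integral_one_add_norm_mul_nonneg _
  refine ⟨2 * C + 2 * G, by positivity,
    fun T ν a M₀ M₁ N U P i x h hν ha hM₁ hN hcont hB hhol₀ hhol t₁ t₂ ht₁ htt ht₂ => ?_⟩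
  have ht₁0 : 0 < t₁ := (mul_pos ha hν).trans ht₁
  have hm₁ : t₁ ∈ Ioo 0 T := ⟨ht₁0, htt.trans_lt ht₂⟩
  have hm₂ : t₂ ∈ Ioo 0 T := ⟨ht₁0.trans_le htt, ht₂⟩
  have hM₀ : 0 ≤ M₀ := (abs_nonneg _).trans (hB i t₁ (Ioo_subset_Ico_self hm₁) x)
  have hτ : 0 ≤ t₂ - t₁ := sub_nonneg.2 htt
  rcases hM₀.eq_or_lt with hM | hM
  · have hz : ∀ t ∈ Ioo 0 T, U i (t, x) = 0 := fun t ht =>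
      abs_nonpos_iff.1 (hM ▸ hB i t (Ioo_subset_Ico_self ht) x)
    rw [hz _ hm₁, hz _ hm₂, sub_zero, abs_zero]
    positivity
  rcases hτ.eq_or_lt with hτ' | hτ'
  · rw [sub_eq_zero.1 hτ'.symm, sub_self, abs_zero, sub_self]
    positivity
  have hδ : 0 < M₀ * (t₂ - t₁) := mul_pos hM hτ'
  have hholQ : ∀ t ∈ Ioo 0 T, ∀ j k y,
      |U j (t, y) * U k (t, y) - U j (t, x) * U k (t, x)| ≤ 2 * M₀ * M₁ * ‖y - x‖ ^ α := by
    intro t ht j k y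
    have ht' := Ioo_subset_Ico_self ht
    calc |U j (t, y) * U k (t, y) - U j (t, x) * U k (t, x)|
        = |U j (t, y) * (U k (t, y) - U k (t, x)) + (U j (t, y) - U j (t, x)) * U k (t, x)| := by
          congr 1; ring
      _ ≤ |U j (t, y)| * |U k (t, y) - U k (t, x)| + |U j (t, y) - U j (t, x)| * |U k (t, x)| := by
          rw [← abs_mul, ← abs_mul]
          exact abs_add_le _ _
      _ ≤ M₀ * (M₁ * ‖y - x‖ ^ α) + M₁ * ‖y - x‖ ^ α * M₀ := by
          gcongr
          · exact hB j t ht' y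
          · exact hhol k t ht' y
          · exact hhol j t ht' y
          · exact hB k t ht' x
      _ = _ := by ring
  set s := (M₀ * (t₂ - t₁)) ^ 2 with hs_def
  have hs : 0 < s := by positivity
  have hsqrt : √s = M₀ * (t₂ - t₁) := Real.sqrt_sq hδ.le
  have e1 := hbd T ν a (2 * M₀ * M₁) N M₀ U P i x h hν ha (by positivity) hN hcont (hB i) hhol₀
    hholQ t₁ t₂ s ht₁ htt ht₂ hs
  have e2 := fun t ht => (h.velocity i).abs_heatFlow_sub_le (x := x) (t := t) (s := s) ht hα hα1
    hM₁ (hhol i t (Ioo_subset_Ico_self ht))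
  rw [← hG, hsqrt] at e2
  have e3 : (M₀ * (t₂ - t₁)) ^ α = M₀ ^ α * (t₂ - t₁) ^ α := Real.mul_rpow hM.le hτ
  have e4 : 2 * M₀ * M₁ * s ^ ((α - 1) / 2) * (t₂ - t₁) = 2 * (M₀ ^ α * M₁ * (t₂ - t₁) ^ α) := by
    have e5 : s ^ ((α - 1) / 2) * (M₀ * (t₂ - t₁)) = (M₀ * (t₂ - t₁)) ^ α := by
      rw [hs_def, ← Real.rpow_natCast, ← Real.rpow_mul hδ.le]
      nth_rewrite 2 [← Real.rpow_one (M₀ * (t₂ - t₁))]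
      rw [← Real.rpow_add hδ]
      congr 1
      push_cast
      ring
    calc _ = 2 * M₁ * (s ^ ((α - 1) / 2) * (M₀ * (t₂ - t₁))) := by ring
      _ = _ := by rw [e5, e3]; ring
  rw [e4] at e1
  rw [e3] at e2
  have e6 := e2 t₁ hm₁
  have e7 := e2 t₂ hm₂
  have e8 : 0 ≤ a ^ (-α / 2) * N * (t₂ - t₁) ^ α := by positivity
  have e9 : |U i (t₂, x) - U i (t₁, x)| ≤ |heatFlow (U i) x t₂ s - U i (t₂, x)|
      + |heatFlow (U i) x t₂ s - heatFlow (U i) x t₁ s| + |heatFlow (U i) x t₁ s - U i (t₁, x)| := by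
    rw [abs_sub_comm (heatFlow (U i) x t₂ s) (U i (t₂, x))]
    calc _ = |(U i (t₂, x) - heatFlow (U i) x t₂ s)
          + (heatFlow (U i) x t₂ s - heatFlow (U i) x t₁ s)
          + (heatFlow (U i) x t₁ s - U i (t₁, x))| := by congr 1; ring
      _ ≤ _ := abs_add_three _ _ _
  have e10 := mul_nonneg hC e8
  have e11 := mul_nonneg hG0 e8
  calc _ ≤ _ := e9
    _ ≤ _ := add_le_add (add_le_add e7 e1) e6
    _ ≤ _ := by linarith

end

end NavierStokesFlow
section

variable {d : ℕ} {T ν : ℝ}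

theorem SmoothPeriodic.deriv_time {f : ℝ × EuclideanSpace ℝ (Fin d) → ℝ}
    (hf : SmoothPeriodic T f) {t : ℝ} (ht : t ∈ Ioo 0 T) (x : EuclideanSpace ℝ (Fin d)) :
    deriv (fun s => f (s, x)) t = timeDeriv f (t, x) :=
  ((hf.differentiableAt (q := (t, x)) ⟨ht, trivial⟩).hasFDerivAt.comp_hasDerivAt t
    ((hasDerivAt_id t).prodMk (hasDerivAt_const t x))).deriv

theorem SmoothPeriodic.fderiv_space {f : ℝ × EuclideanSpace ℝ (Fin d) → ℝ}
    (hf : SmoothPeriodic T f) {t : ℝ} (ht : t ∈ Ioo 0 T) (x : EuclideanSpace ℝ (Fin d))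
    (j : Fin d) :
    fderiv ℝ (fun y => f (t, y)) x (EuclideanSpace.single j 1) = spaceDeriv j f (t, x) := by
  have h := (hf.differentiableAt (q := (t, x)) ⟨ht, trivial⟩).hasFDerivAt.comp x
    ((hasFDerivAt_const t x).prodMk (hasFDerivAt_id x))
  exact congrArg (fun A => A (EuclideanSpace.single j (1 : ℝ))) h.fderiv

theorem NavierStokesFlow.of_solution
    {u : ℝ → EuclideanSpace ℝ (Fin d) → EuclideanSpace ℝ (Fin d)}
    {p : ℝ → EuclideanSpace ℝ (Fin d) → ℝ}
    (hu : ContDiffOn ℝ (⊤ : ℕ∞) (fun q : ℝ × EuclideanSpace ℝ (Fin d) => u q.1 q.2)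
      (Ioo 0 T ×ˢ univ))
    (hp : ContDiffOn ℝ (⊤ : ℕ∞) (fun q : ℝ × EuclideanSpace ℝ (Fin d) => p q.1 q.2)
      (Ioo 0 T ×ˢ univ))
    (hup : ∀ (t : ℝ) (x : EuclideanSpace ℝ (Fin d)) (n : Fin d → ℤ),
      u t (x + (EuclideanSpace.equiv (Fin d) ℝ).symm (fun i => (n i : ℝ))) = u t x)
    (hpp : ∀ (t : ℝ) (x : EuclideanSpace ℝ (Fin d)) (n : Fin d → ℤ),
      p t (x + (EuclideanSpace.equiv (Fin d) ℝ).symm (fun i => (n i : ℝ))) = p t x)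
    (hmom : ∀ t ∈ Ioo (0 : ℝ) T, ∀ (x : EuclideanSpace ℝ (Fin d)) (i : Fin d),
      deriv (fun s => u s x i) t
          + ∑ j, u t x j * fderiv ℝ (fun y => u t y i) x (EuclideanSpace.single j 1)
          + fderiv ℝ (fun y => p t y) x (EuclideanSpace.single i 1)
        = ν * ∑ j, fderiv ℝ (fun y => fderiv ℝ (fun z => u t z i) y
            (EuclideanSpace.single j 1)) x (EuclideanSpace.single j 1))
    (hdiv : ∀ t ∈ Ioo (0 : ℝ) T, ∀ x : EuclideanSpace ℝ (Fin d),
      ∑ i, fderiv ℝ (fun y => u t y i) x (EuclideanSpace.single i 1) = 0) :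
    NavierStokesFlow T ν (fun i q => u q.1 q.2 i) (fun q => p q.1 q.2) := by
  have hU : ∀ i, SmoothPeriodic T (fun q : ℝ × EuclideanSpace ℝ (Fin d) => u q.1 q.2 i) :=
    fun i => ⟨contDiffOn_euclidean.1 hu i, fun t _ x n => congrArg (fun v => v i) (hup t x n)⟩
  have hP : SmoothPeriodic T (fun q : ℝ × EuclideanSpace ℝ (Fin d) => p q.1 q.2) :=
    ⟨hp, fun t _ x n => hpp t x n⟩
  refine ⟨hU, hP, fun i q hq => ?_, fun q hq => ?_⟩
  · have h1 := hmom q.1 hq.1 q.2 i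
    have h2 := (hU i).deriv_time hq.1 q.2
    have h3 := fun y j => (hU i).fderiv_space hq.1 y j
    have h4 := hP.fderiv_space hq.1 q.2 i
    have h5 := fun j => ((hU i).of_spaceDeriv j).fderiv_space hq.1 q.2 j
    simp only at h2 h3 h4 h5
    simp only [h2, h3, h4, h5] at h1
    exact h1
  · have h1 := hdiv q.1 hq.1 q.2
    have h3 := fun i => (hU i).fderiv_space hq.1 q.2 i
    simp only at h3
    simpa only [h3] using h1

theorem nonneg_of_norm_sub_le_mul_rpow {E F : Type*} [NormedAddCommGroup E] [Nontrivial E]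
    [SeminormedAddCommGroup F] {g : E → F} {L α : ℝ}
    (h : ∀ x y, ‖g x - g y‖ ≤ L * ‖x - y‖ ^ α) : 0 ≤ L := by
  obtain ⟨x, hx⟩ := exists_ne (0 : E)
  have h1 := (norm_nonneg _).trans (h x 0)
  rw [sub_zero] at h1
  exact nonneg_of_mul_nonneg_left h1 (Real.rpow_pos_of_pos (norm_pos_iff.2 hx) α)

theorem norm_le_mul_of_abs_apply_le {v : EuclideanSpace ℝ (Fin d)} {b : ℝ}
    (h : ∀ i, |v i| ≤ b) : ‖v‖ ≤ d * b := by
  calc ‖v‖ = ‖∑ i, v i • EuclideanSpace.single i (1 : ℝ)‖ := by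
        congr 1
        ext j
        simp [Finset.sum_apply, Pi.single_apply]
    _ ≤ ∑ i, ‖v i • EuclideanSpace.single i (1 : ℝ)‖ := norm_sum_le _ _
    _ ≤ ∑ _i : Fin d, b := by
        gcongr with i
        simpa [norm_smul] using h i
    _ = d * b := by simp

end

/-- viscosity-independent joint space-time Hölder estimate on `(aν, T) × ℝ^d`. -/
theorem stmt1 (d : ℕ) (hd : 2 ≤ d) (α : ℝ) (hα : 0 < α) (hα1 : α < 1) :
    ∃ C : ℝ, 0 < C ∧
      ∀ T ν : ℝ, 0 < T → 0 < ν →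
      ∀ (u : ℝ → EuclideanSpace ℝ (Fin d) → EuclideanSpace ℝ (Fin d)) (p : ℝ → EuclideanSpace ℝ (Fin d) → ℝ),
        ContinuousOn (fun q : ℝ × EuclideanSpace ℝ (Fin d) => u q.1 q.2) (Ico 0 T ×ˢ univ) →
        ContDiffOn ℝ (⊤ : ℕ∞) (fun q : ℝ × EuclideanSpace ℝ (Fin d) => u q.1 q.2) (Ioo 0 T ×ˢ univ) →
        ContDiffOn ℝ (⊤ : ℕ∞) (fun q : ℝ × EuclideanSpace ℝ (Fin d) => p q.1 q.2) (Ioo 0 T ×ˢ univ) →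
        (∀ (t : ℝ) (x : EuclideanSpace ℝ (Fin d)) (n : Fin d → ℤ), u t (x + (EuclideanSpace.equiv (Fin d) ℝ).symm (fun i => (n i : ℝ))) = u t x) →
        (∀ (t : ℝ) (x : EuclideanSpace ℝ (Fin d)) (n : Fin d → ℤ), p t (x + (EuclideanSpace.equiv (Fin d) ℝ).symm (fun i => (n i : ℝ))) = p t x) →
        (∀ t ∈ Ioo (0 : ℝ) T, ∀ (x : EuclideanSpace ℝ (Fin d)) (i : Fin d),
          deriv (fun s => u s x i) t
              + ∑ j, u t x j * fderiv ℝ (fun y => u t y i) x (EuclideanSpace.single j 1)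
              + fderiv ℝ (fun y => p t y) x (EuclideanSpace.single i 1)
            = ν * ∑ j, fderiv ℝ (fun y => fderiv ℝ (fun z => u t z i) y
                (EuclideanSpace.single j 1)) x (EuclideanSpace.single j 1)) →
        (∀ t ∈ Ioo (0 : ℝ) T, ∀ x : EuclideanSpace ℝ (Fin d),
          ∑ i, fderiv ℝ (fun y => u t y i) x (EuclideanSpace.single i 1) = 0) →
        ∀ M₀ M₁ : ℝ,
          (∀ t ∈ Ico (0 : ℝ) T, ∀ x, ‖u t x‖ ≤ M₀) →
          (∀ t ∈ Ico (0 : ℝ) T, ∀ x y, ‖u t x - u t y‖ ≤ M₁ * ‖x - y‖ ^ α) →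
          ∀ N : ℝ,
            (∀ x y, ‖u 0 x - u 0 y‖ ≤ N * ‖x - y‖ ^ α) →
            ∀ a : ℝ, 0 < a →
              ∀ t₁ t₂ : ℝ, t₁ ∈ Ioo (a * ν) T → t₂ ∈ Ioo (a * ν) T →
                ∀ x₁ x₂ : EuclideanSpace ℝ (Fin d),
                  ‖u t₁ x₁ - u t₂ x₂‖ ≤
                    C * (M₀ ^ α * M₁ + M₀ + M₁ + a ^ (-α / 2) * N) *
                      (|t₁ - t₂| ^ α + ‖x₁ - x₂‖ ^ α) := by
  obtain ⟨C, hC, hbd⟩ := NavierStokesFlow.exists_abs_velocity_sub_le d hα hα1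
  refine ⟨d * C + 1, by positivity, ?_⟩
  intro T ν hT hν u p hcont hu hp hup hpp hmom hdiv M₀ M₁ hM₀ hM₁ N hN a ha t₁ t₂ ht₁ ht₂ x₁ x₂
  have : Nontrivial (Fin d) := Fin.nontrivial_iff_two_le.2 hd
  have hflow := NavierStokesFlow.of_solution hu hp hup hpp hmom hdiv
  have hcoord : ∀ (v : EuclideanSpace ℝ (Fin d)) i, |v i| ≤ ‖v‖ := fun v i =>
    PiLp.norm_apply_le v i
  have h0 : (0 : ℝ) ∈ Ico 0 T := ⟨le_rfl, hT⟩
  have hM₀0 : 0 ≤ M₀ := (norm_nonneg _).trans (hM₀ 0 h0 0)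
  have hM₁0 : 0 ≤ M₁ := nonneg_of_norm_sub_le_mul_rpow (hM₁ 0 h0)
  have hN0 : 0 ≤ N := nonneg_of_norm_sub_le_mul_rpow hN
  set A := M₀ ^ α * M₁ + a ^ (-α / 2) * N with hA
  have hA0 : 0 ≤ A := by positivity
  have htime : ∀ t t', a * ν < t → t ≤ t' → t' < T → ∀ x,
      ‖u t' x - u t x‖ ≤ d * C * A * (t' - t) ^ α := by
    intro t t' h1 h2 h3 x
    rw [mul_assoc, mul_assoc, ← mul_assoc C]
    refine norm_le_mul_of_abs_apply_le fun i => ?_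
    exact hbd T ν a M₀ M₁ N _ _ i x hflow hν ha hM₁0 hN0
      ((EuclideanSpace.proj i).continuous.comp_continuousOn hcont)
      (fun j t ht y => (hcoord _ j).trans (hM₀ t ht y))
      (fun y => (hcoord (u 0 y - u 0 x) i).trans (hN y x))
      (fun j t ht y => (hcoord (u t y - u t x) j).trans (hM₁ t ht y x)) t t' h1 h2 h3
  have htime' : ‖u t₁ x₂ - u t₂ x₂‖ ≤ d * C * A * |t₁ - t₂| ^ α := by
    rcases le_total t₁ t₂ with h | h
    · rw [norm_sub_rev, abs_sub_comm, abs_of_nonneg (sub_nonneg.2 h)]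
      exact htime t₁ t₂ ht₁.1 h ht₂.2 x₂
    · rw [abs_of_nonneg (sub_nonneg.2 h)]
      exact htime t₂ t₁ ht₂.1 h ht₁.2 x₂
  have hspace := hM₁ t₁ ⟨((mul_pos ha hν).trans ht₁.1).le, ht₁.2⟩ x₁ x₂
  have hX : 0 ≤ ‖x₁ - x₂‖ ^ α := by positivity
  have hτ : 0 ≤ |t₁ - t₂| ^ α := by positivity
  have hdC : 0 ≤ d * C := by positivity
  have e1 : d * C * A ≤ (d * C + 1) * (A + M₀ + M₁) := by
    gcongr <;> linarith
  have e2 : M₁ ≤ (d * C + 1) * (A + M₀ + M₁) := by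
    calc M₁ = 1 * M₁ := (one_mul _).symm
      _ ≤ _ := by gcongr <;> linarith
  calc ‖u t₁ x₁ - u t₂ x₂‖ ≤ ‖u t₁ x₂ - u t₂ x₂‖ + ‖u t₁ x₁ - u t₁ x₂‖ := by
        rw [add_comm]
        exact norm_sub_le_norm_sub_add_norm_sub _ _ _
    _ ≤ (d * C + 1) * (A + M₀ + M₁) * |t₁ - t₂| ^ α
        + (d * C + 1) * (A + M₀ + M₁) * ‖x₁ - x₂‖ ^ α :=
      add_le_add (htime'.trans (by gcongr)) (hspace.trans (by gcongr))
    _ = _ := by rw [hA]; ring
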